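/- arXiv:0910.1899 — 4 statements merged into one kernel-verified Lean document; each statement's English description precedes it below -/
import Mathlib

section
/- Let n ≥ 2. There is a computable function d : List (Fin n × Bool) → List (Fin n × Bool) → Bool such that for all words U, V : List (Fin n × Bool), d U V = true if and only if there exists an injective group homomorphism f : FreeGroup (Fin n) →* FreeGroup (Fin n) with f (FreeGroup.mk U) = FreeGroup.mk V. In other words, the monomorphism problem in the free group of rank n is decidable: one can decide, given u and v, whether some monomorphism of the free group sends u to v. -/
namespace MP

open FreeGroup
set_option linter.unusedSectionVars false

section basics
variable {α : Type*} [DecidableEq α]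

/-- inverse letter -/
def bar (x : α × Bool) : α × Bool := (x.1, !x.2)

@[simp] lemma bar_bar (x : α × Bool) : bar (bar x) = x := by
  simp [bar]

lemma bar_ne (x : α × Bool) : bar x ≠ x := by
  rcases x with ⟨a, b⟩; cases b <;> simp [bar]

/-- letter as group element -/
def lt (x : α × Bool) : FreeGroup α := FreeGroup.mk [x]

lemma lt_bar (x : α × Bool) : lt (bar x) = (lt x)⁻¹ := by
  simp [lt, bar, FreeGroup.inv_mk, FreeGroup.invRev]

@[simp] lemma lt_mul_bar (x : α × Bool) : lt x * lt (bar x) = 1 := by simp [lt_bar]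
@[simp] lemma bar_mul_lt (x : α × Bool) : lt (bar x) * lt x = 1 := by simp [lt_bar]

lemma mk_cons (x : α × Bool) (l : List (α × Bool)) : FreeGroup.mk (x :: l) = lt x * FreeGroup.mk l := by
  simp [lt, FreeGroup.mul_mk]

lemma mk_concat (x : α × Bool) (l : List (α × Bool)) :
    FreeGroup.mk (l ++ [x]) = FreeGroup.mk l * lt x := by
  simp [lt, FreeGroup.mul_mk]

lemma toWord_mk_of_red {l : List (α × Bool)} (h : IsReduced l) : (FreeGroup.mk l).toWord = l := by
  rw [toWord_mk, h.reduce_eq]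

@[simp] lemma toWord_lt (x : α × Bool) : (lt x).toWord = [x] := by
  simp [lt, toWord_mk]

lemma red_cons {x : α × Bool} {l : List (α × Bool)} :
    IsReduced (x :: l) ↔ (∀ y ∈ l.head?, y ≠ bar x) ∧ IsReduced l := by
  unfold FreeGroup.IsReduced
  rw [List.isChain_cons]
  refine and_congr ⟨fun h y hy => ?_, fun h y hy => ?_⟩ Iff.rfl
  · have := h y hy
    rintro rfl
    simp [bar] at this
  · have := h y hy
    rintro h1
    rcases x with ⟨a, b⟩; rcases y with ⟨c, d⟩
    simp [bar] at *
    subst h1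
    simpa [eq_comm] using this rfl

lemma red_concat {x : α × Bool} {l : List (α × Bool)} :
    IsReduced (l ++ [x]) ↔ (∀ y ∈ l.getLast?, y ≠ bar x) ∧ IsReduced l := by
  unfold FreeGroup.IsReduced
  rw [List.isChain_append]
  constructor
  · rintro ⟨h1, -, h2⟩
    refine ⟨fun y hy => ?_, h1⟩
    have := h2 y hy x (by simp)
    rintro rfl
    simp [bar] at this
  · rintro ⟨h1, h2⟩
    refine ⟨h2, by simp, fun y hy z hz => ?_⟩
    have := h1 y hy
    simp at hz; subst hz
    intro h3
    rcases x with ⟨a, b⟩; rcases y with ⟨c, d⟩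
    simp [bar] at this h3 ⊢
    exact this h3

lemma toWord_lt_mul (x : α × Bool) (g : FreeGroup α) :
    (g.toWord = bar x :: (lt x * g).toWord) ∨
      (g.toWord.head? ≠ some (bar x) ∧ (lt x * g).toWord = x :: g.toWord) := by
  rcases h : g.toWord with _ | ⟨y, l⟩
  · right
    have : g = 1 := toWord_eq_nil_iff.1 h
    subst this; simp
  · have hr : IsReduced (y :: l) := h ▸ isReduced_toWord
    have hg : g = lt y * FreeGroup.mk l := by rw [← mk_cons, ← h, mk_toWord]
    by_cases hy : y = bar x
    · left
      subst hy
      rw [hg, ← mul_assoc, lt_mul_bar, one_mul, toWord_mk_of_red (red_cons.1 hr).2]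
    · right
      refine ⟨by simpa using hy, ?_⟩
      rw [hg, ← mk_cons, ← mk_cons, toWord_mk_of_red]
      rw [red_cons]; exact ⟨by simpa using hy, hr⟩

lemma toWord_mul_lt (x : α × Bool) (g : FreeGroup α) :
    (g.toWord = (g * lt x).toWord ++ [bar x]) ∨
      (g.toWord.getLast? ≠ some (bar x) ∧ (g * lt x).toWord = g.toWord ++ [x]) := by
  rcases List.eq_nil_or_concat g.toWord with h | ⟨l, y, h⟩
  · right
    have : g = 1 := toWord_eq_nil_iff.1 h
    subst this; simp
  · rw [List.concat_eq_append] at h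
    have hr : IsReduced (l ++ [y]) := h ▸ isReduced_toWord
    have hg : g = FreeGroup.mk l * lt y := by rw [← mk_concat, ← h, mk_toWord]
    by_cases hy : y = bar x
    · left
      subst hy
      have : g * lt x = FreeGroup.mk l := by
        rw [hg, mul_assoc, bar_mul_lt, mul_one]
      rw [this, toWord_mk_of_red (red_concat.1 hr).2, h]
    · right
      refine ⟨by simpa [h] using hy, ?_⟩
      rw [hg, ← mk_concat, ← mk_concat, toWord_mk_of_red, toWord_mk_of_red hr]
      rw [red_concat]; exact ⟨by simpa using hy, hr⟩

/-- half space: words beginning with x -/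
def E (x : α × Bool) : Set (FreeGroup α) := {g | g.toWord.head? = some x}

lemma one_notMem_E (x : α × Bool) : (1 : FreeGroup α) ∉ E x := by simp [E]

lemma lt_mem_E {x y : α × Bool} : lt y ∈ E x ↔ y = x := by simp [E]

lemma E_disj {x y : α × Bool} {g : FreeGroup α} (h : g ∈ E x) (h' : g ∈ E y) : x = y := by
  simp only [E, Set.mem_ofPred_eq] at h h'
  simpa [h] using h'

lemma mem_some_E (g : FreeGroup α) : g = 1 ∨ ∃ x, g ∈ E x := by
  rcases h : g.toWord with _ | ⟨y, l⟩
  · left; exact toWord_eq_nil_iff.1 h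
  · right; exact ⟨y, by simp [E, h]⟩

lemma lt_mul_mem_E (x : α × Bool) (g : FreeGroup α) : lt x * g ∈ E x ↔ g ∉ E (bar x) := by
  simp only [E, Set.mem_ofPred_eq]
  rcases toWord_lt_mul x g with h | ⟨h, h'⟩
  · rw [h]
    have : IsReduced (bar x :: (lt x * g).toWord) := h ▸ isReduced_toWord
    have := (red_cons.1 this).1 x
    simp at this ⊢
    exact this
  · simp [h', h]

lemma E_enter (x y : α × Bool) (g : FreeGroup α) :
    (g ∉ E x ∧ g * lt y ∈ E x) ↔ (y = x ∧ g = 1) := by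
  constructor
  · rintro ⟨h1, h2⟩
    simp only [E, Set.mem_ofPred_eq] at h1 h2
    rcases toWord_mul_lt y g with h | ⟨h, h'⟩
    · rw [h] at h1
      exfalso; apply h1
      rw [List.head?_append, h2]; rfl
    · rw [h', List.head?_append] at h2
      rcases hg : g.toWord with _ | ⟨z, l⟩
      · have : g = 1 := toWord_eq_nil_iff.1 hg
        subst this; simpa using h2
      · rw [hg] at h1 h2; simp at h1 h2; exact absurd h2 h1
  · rintro ⟨rfl, rfl⟩
    exact ⟨one_notMem_E _, by simp [lt_mem_E]⟩

lemma E_leave (x y : α × Bool) (g : FreeGroup α) :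
    (g ∈ E x ∧ g * lt y ∉ E x) ↔ (y = bar x ∧ g = lt x) := by
  have := E_enter x (bar y) (g * lt y)
  rw [mul_assoc, lt_mul_bar, mul_one, and_comm] at this
  rw [this]
  constructor
  · rintro ⟨rfl, h⟩; simp
    rw [lt_bar]; exact eq_inv_of_mul_eq_one_left h
  · rintro ⟨rfl, rfl⟩; simp

lemma reduced_append_right {l m : List (α × Bool)} (h : IsReduced (l ++ m)) : IsReduced m := by
  unfold FreeGroup.IsReduced at *
  exact (List.isChain_append.1 h).2.1

lemma reduced_append_left {l m : List (α × Bool)} (h : IsReduced (l ++ m)) : IsReduced l := by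
  unfold FreeGroup.IsReduced at *
  exact (List.isChain_append.1 h).1

/-- translated half spaces are cylinders -/
lemma cyl (s : List (α × Bool)) (y : α × Bool) (h : IsReduced (s ++ [y])) (g : FreeGroup α) :
    (FreeGroup.mk s)⁻¹ * g ∈ E y ↔ (s ++ [y]) <+: g.toWord := by
  induction s generalizing g with
  | nil =>
    simp only [E, Set.mem_ofPred_eq, ← FreeGroup.one_eq_mk, inv_one, one_mul, List.nil_append]
    rcases g.toWord with _ | ⟨z, l⟩
    · simp
    · simp [eq_comm]
  | cons x s ih =>
    have h2 := red_cons.1 (by simpa using h : IsReduced (x :: (s ++ [y])))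
    have : (FreeGroup.mk (x :: s))⁻¹ * g = (FreeGroup.mk s)⁻¹ * (lt (bar x) * g) := by
      rw [mk_cons, lt_bar]; group
    rw [this, ih h2.2]
    rcases toWord_lt_mul (bar x) g with h' | ⟨h', h''⟩
    · rw [h']; simp
    · rw [h'']
      constructor
      · rintro ⟨t, ht⟩
        exfalso
        refine h2.1 (bar x) ?_ rfl
        have := congrArg List.head? ht
        simp only [List.append_assoc, List.cons_append, List.nil_append, List.head?_cons] at this
        cases s <;> simpa using this
      · rintro ⟨t, ht⟩
        exfalso
        apply h'
        rw [← ht]; simp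

end basics
end MP


namespace MP

open FreeGroup
set_option linter.unusedSectionVars false

section sets
variable {α : Type*} [DecidableEq α]

/-- translate -/
def tr (h : FreeGroup α) (S : Set (FreeGroup α)) : Set (FreeGroup α) := {g | h⁻¹ * g ∈ S}

/-- image under an automorphism -/
def im (φ : MulAut (FreeGroup α)) (S : Set (FreeGroup α)) : Set (FreeGroup α) := {g | φ⁻¹ g ∈ S}

@[simp] lemma mem_tr {h g : FreeGroup α} {S : Set (FreeGroup α)} : g ∈ tr h S ↔ h⁻¹ * g ∈ S := Iff.rfl
@[simp] lemma mem_im {φ : MulAut (FreeGroup α)} {g : FreeGroup α} {S : Set (FreeGroup α)} :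
    g ∈ im φ S ↔ φ⁻¹ g ∈ S := Iff.rfl

lemma tr_compl (h : FreeGroup α) (S : Set (FreeGroup α)) : tr h Sᶜ = (tr h S)ᶜ := rfl
lemma im_compl (φ : MulAut (FreeGroup α)) (S : Set (FreeGroup α)) : im φ Sᶜ = (im φ S)ᶜ := rfl

lemma tr_tr (h k : FreeGroup α) (S : Set (FreeGroup α)) : tr h (tr k S) = tr (h * k) S := by
  ext g; simp [mul_assoc]

lemma tr_one (S : Set (FreeGroup α)) : tr 1 S = S := by
  ext g; simp

lemma im_im (φ ψ : MulAut (FreeGroup α)) (S : Set (FreeGroup α)) : im φ (im ψ S) = im (φ * ψ) S := by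
  ext g; simp

lemma im_one (S : Set (FreeGroup α)) : im 1 S = S := by
  ext g; simp

lemma im_tr (φ : MulAut (FreeGroup α)) (h : FreeGroup α) (S : Set (FreeGroup α)) :
    im φ (tr h S) = tr (φ h) (im φ S) := by
  ext g; simp

lemma E_compl (x : α × Bool) : (E x)ᶜ = tr (lt x) (E (bar x)) := by
  ext g
  have := lt_mul_mem_E (bar x) g
  simp only [bar_bar] at this
  rw [mem_tr, ← lt_bar, this]; rfl

/-- crossing -/
def cross (A B : Set (FreeGroup α)) : Prop :=
  (∃ g, g ∈ A ∧ g ∈ B) ∧ (∃ g, g ∈ A ∧ g ∉ B) ∧ (∃ g, g ∉ A ∧ g ∈ B) ∧ (∃ g, g ∉ A ∧ g ∉ B)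

lemma cross_symm {A B : Set (FreeGroup α)} (h : cross A B) : cross B A := by
  obtain ⟨⟨a, ha⟩, ⟨b, hb⟩, ⟨c, hc⟩, ⟨d, hd⟩⟩ := h
  exact ⟨⟨a, ha.2, ha.1⟩, ⟨c, hc.2, hc.1⟩, ⟨b, hb.2, hb.1⟩, ⟨d, hd.2, hd.1⟩⟩

lemma cross_comm {A B : Set (FreeGroup α)} : cross A B ↔ cross B A := ⟨cross_symm, cross_symm⟩

lemma cross_compl_right {A B : Set (FreeGroup α)} : cross A Bᶜ ↔ cross A B := by
  simp only [cross, Set.mem_compl_iff, not_not]; tauto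

lemma cross_compl_left {A B : Set (FreeGroup α)} : cross Aᶜ B ↔ cross A B := by
  rw [cross_comm, cross_compl_right, cross_comm]

lemma cross_tr {h : FreeGroup α} {A B : Set (FreeGroup α)} : cross (tr h A) (tr h B) ↔ cross A B := by
  have (P : FreeGroup α → Prop) : (∃ g, P (h⁻¹ * g)) ↔ ∃ g, P g :=
    ⟨fun ⟨g, hg⟩ => ⟨_, hg⟩, fun ⟨g, hg⟩ => ⟨h * g, by simpa using hg⟩⟩
  simp only [cross, mem_tr]
  rw [this (fun g => g ∈ A ∧ g ∈ B), this (fun g => g ∈ A ∧ g ∉ B), this (fun g => g ∉ A ∧ g ∈ B),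
    this (fun g => g ∉ A ∧ g ∉ B)]

lemma cross_im {φ : MulAut (FreeGroup α)} {A B : Set (FreeGroup α)} :
    cross (im φ A) (im φ B) ↔ cross A B := by
  have (P : FreeGroup α → Prop) : (∃ g, P (φ⁻¹ g)) ↔ ∃ g, P g :=
    ⟨fun ⟨g, hg⟩ => ⟨_, hg⟩, fun ⟨g, hg⟩ => ⟨φ g, by simpa using hg⟩⟩
  simp only [cross, mem_im]
  rw [this (fun g => g ∈ A ∧ g ∈ B), this (fun g => g ∈ A ∧ g ∉ B), this (fun g => g ∉ A ∧ g ∈ B),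
    this (fun g => g ∉ A ∧ g ∉ B)]

/-- places where S separates g from g u -/
def Dl (u : FreeGroup α) (S : Set (FreeGroup α)) : Set (FreeGroup α) := {g | ¬ (g ∈ S ↔ g * u ∈ S)}

lemma mem_Dl {u g : FreeGroup α} {S : Set (FreeGroup α)} : g ∈ Dl u S ↔ ¬ (g ∈ S ↔ g * u ∈ S) := Iff.rfl

/-- almost invariant -/
def AI (S : Set (FreeGroup α)) : Prop := ∀ u, (Dl u S).Finite

noncomputable def c (u : FreeGroup α) (S : Set (FreeGroup α)) : ℕ := (Dl u S).ncard

lemma Dl_compl (u : FreeGroup α) (S : Set (FreeGroup α)) : Dl u Sᶜ = Dl u S := by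
  ext g; simp only [mem_Dl, Set.mem_compl_iff]; tauto

lemma Dl_tr (u h : FreeGroup α) (S : Set (FreeGroup α)) : Dl u (tr h S) = (fun g => h * g) '' Dl u S := by
  ext g
  simp only [Set.mem_image, mem_Dl, mem_tr]
  constructor
  · intro hg
    exact ⟨h⁻¹ * g, by simpa [mul_assoc] using hg, by simp⟩
  · rintro ⟨g, hg, rfl⟩
    simpa [mul_assoc] using hg

lemma Dl_im (u : FreeGroup α) (φ : MulAut (FreeGroup α)) (S : Set (FreeGroup α)) :
    Dl u (im φ S) = φ '' Dl (φ⁻¹ u) S := by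
  ext g
  simp only [Set.mem_image, mem_Dl, mem_im]
  constructor
  · intro hg
    exact ⟨φ⁻¹ g, by simpa using hg, by simp⟩
  · rintro ⟨g, hg, rfl⟩
    simpa using hg

lemma c_compl (u : FreeGroup α) (S : Set (FreeGroup α)) : c u Sᶜ = c u S := by simp [c, Dl_compl]
lemma c_tr (u h : FreeGroup α) (S : Set (FreeGroup α)) : c u (tr h S) = c u S := by
  rw [c, Dl_tr, Set.ncard_image_of_injective _ (mul_right_injective h)]; rfl
lemma c_im (u : FreeGroup α) (φ : MulAut (FreeGroup α)) (S : Set (FreeGroup α)) :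
    c u (im φ S) = c (φ⁻¹ u) S := by
  rw [c, Dl_im, Set.ncard_image_of_injective _ φ.injective]; rfl

lemma AI.compl {S : Set (FreeGroup α)} (h : AI S) : AI Sᶜ := fun u => by rw [Dl_compl]; exact h u
lemma AI.tr {S : Set (FreeGroup α)} (h : AI S) (k) : AI (tr k S) := fun u => by
  rw [Dl_tr]; exact (h u).image _
lemma AI.im {S : Set (FreeGroup α)} (h : AI S) (φ) : AI (im φ S) := fun u => by
  rw [Dl_im]; exact (h _).image _

lemma Dl_lt_E (x y : α × Bool) :
    Dl (lt y) (E x) = {g | (y = x ∧ g = 1) ∨ (y = bar x ∧ g = lt x)} := by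
  ext g
  rw [Set.mem_ofPred_eq, ← E_enter, ← E_leave, mem_Dl]; tauto

lemma AI_of_letters {S : Set (FreeGroup α)} (h : ∀ y, (Dl (lt y) S).Finite) : AI S := by
  intro u
  induction u using FreeGroup.induction_on with
  | C1 => simp [Dl]
  | of a => exact h (a, true)
  | inv_of a ih =>
    have := h (a, false)
    have e : lt (a, false) = (FreeGroup.of a)⁻¹ := lt_bar (a, true)
    rwa [e] at this
  | mul u v hu hv =>
    refine (hu.union (hv.preimage (f := fun g => g * u) (mul_left_injective u).injOn)).subset ?_
    intro g hg
    simp only [Set.mem_union, Set.mem_preimage, mem_Dl, mul_assoc] at *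
    tauto

lemma AI_E (x : α × Bool) : AI (E x) := by
  apply AI_of_letters
  intro y
  rw [Dl_lt_E]
  refine (Set.toFinite {1, lt x}).subset ?_
  rintro g (⟨-, rfl⟩ | ⟨-, rfl⟩) <;> simp

lemma c_cons (y : α × Bool) (r : FreeGroup α) (hr : r ∉ E (bar y)) (i : α) :
    c (lt y * r) (E (i, true)) = c r (E (i, true)) + if y.1 = i then 1 else 0 := by
  have h1 : Dl (lt y * r) (E (i, true)) =
      (fun g => g * lt (bar y)) '' {g | ¬ (g * lt (bar y) ∈ E (i, true) ↔ g * r ∈ E (i, true))} := by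
    ext g
    simp only [Set.mem_image, mem_Dl, Set.mem_ofPred_eq]
    constructor
    · intro h
      exact ⟨g * lt y, by simpa [mul_assoc] using h, by simp [mul_assoc]⟩
    · rintro ⟨g, h, rfl⟩
      rw [mul_assoc, ← mul_assoc (lt (bar y))]
      simpa using h
  rw [c, h1, Set.ncard_image_of_injective _ (mul_left_injective _)]
  have key : ∀ g, (g ∈ E (i, true) ↔ g * lt (bar y) ∈ E (i, true)) ↔
      ¬ ((bar y = (i, true) ∧ g = 1) ∨ (bar y = bar (i, true) ∧ g = lt (i, true))) := by
    intro g
    have := Set.ext_iff.1 (Dl_lt_E (i, true) (bar y)) g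
    rw [mem_Dl, Set.mem_ofPred_eq] at this
    rw [← this, not_not]
  split_ifs with hi
  · obtain ⟨g0, hg0, hg1⟩ : ∃ g0, g0 ∉ Dl r (E (i, true)) ∧ ∀ g, (g ∈ E (i, true) ↔ g * lt (bar y) ∈ E (i, true)) ↔ g ≠ g0 := by
      rcases y with ⟨a, b⟩
      simp only at hi; subst hi
      cases b
      · refine ⟨1, ?_, fun g => by rw [key]; simp [bar]⟩
        simp only [bar, Bool.not_false] at hr
        simp [mem_Dl, hr, one_notMem_E]
      · refine ⟨lt (a, true), ?_, fun g => by rw [key]; simp [bar]⟩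
        simp [mem_Dl, lt_mul_mem_E, hr, lt_mem_E]
    have : {g | ¬ (g * lt (bar y) ∈ E (i, true) ↔ g * r ∈ E (i, true))} = insert g0 (Dl r (E (i, true))) := by
      ext g
      have h1 := hg1 g
      rw [Set.mem_insert_iff, mem_Dl, Set.mem_ofPred_eq]
      by_cases hg : g = g0
      · subst hg
        rw [mem_Dl] at hg0
        tauto
      · tauto
    rw [this, Set.ncard_insert_of_notMem hg0 (AI_E _ _)]; rfl
  · have : {g | ¬ (g * lt (bar y) ∈ E (i, true) ↔ g * r ∈ E (i, true))} = Dl r (E (i, true)) := by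
      ext g
      have h1 := key g
      have h2 : bar y ≠ (i, true) := fun h => hi (by rw [← bar_bar y, h]; rfl)
      have h3 : bar y ≠ bar (i, true) := fun h => hi (by rw [← bar_bar y, h]; rfl)
      rw [mem_Dl, Set.mem_ofPred_eq]
      tauto
    rw [this]; rfl

lemma sum_c [Fintype α] (u : FreeGroup α) : ∑ i, c u (E (i, true)) = u.norm := by
  suffices ∀ l : List (α × Bool), IsReduced l → ∑ i, c (FreeGroup.mk l) (E (i, true)) = l.length by
    have := this u.toWord isReduced_toWord
    rwa [mk_toWord] at this
  intro l
  induction l with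
  | nil => intro _; simp [c, Dl, ← FreeGroup.one_eq_mk]
  | cons y l ih =>
    intro h
    rw [red_cons] at h
    have hr : FreeGroup.mk l ∉ E (bar y) := by
      intro h'
      simp only [E, Set.mem_ofPred_eq, toWord_mk_of_red h.2] at h'
      exact h.1 _ h' rfl
    simp only [mk_cons, c_cons _ _ hr, Finset.sum_add_distrib, ih h.2]
    simp

/-- finitely many half spaces cross an almost invariant set -/
lemma finite_cross [Fintype α] {S : Set (FreeGroup α)} (hS : AI S) (x : α × Bool) :
    {g | cross S (tr g (E x))}.Finite := by
  set V : Set (FreeGroup α) := ⋃ y, Dl (lt y) S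
  have hV : V.Finite := Set.finite_iUnion fun y => hS _
  have key : ∀ (x : α × Bool) (h : FreeGroup α), (∃ g, g ∈ S ∧ g ∈ tr h (E x)) →
      (∃ g, g ∉ S ∧ g ∈ tr h (E x)) → ∃ a ∈ V, a ∈ tr h (E x) := by
    rintro x h ⟨g1, h1, h1'⟩ ⟨g2, h2, h2'⟩
    by_contra! hcon
    have : ∀ l : List (α × Bool), IsReduced (x :: l) →
        (h * FreeGroup.mk (x :: l) ∈ S ↔ h * lt x ∈ S) := by
      intro l
      induction l using List.reverseRecOn with
      | nil => intro _; rfl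
      | append_singleton l y ih =>
        intro hl
        rw [← List.cons_append] at hl ⊢
        have hl' := reduced_append_left hl
        rw [mk_concat, ← mul_assoc, ← ih hl']
        have hm : h * FreeGroup.mk (x :: l) ∈ tr h (E x) := by
          simp [E, toWord_mk_of_red hl', -toWord_mk]
        have : h * FreeGroup.mk (x :: l) ∉ V := fun h' => hcon _ h' hm
        simp only [V, Set.mem_iUnion, not_exists, mem_Dl, not_not] at this
        exact (this y).symm
    have h3 : ∀ g, g ∈ tr h (E x) → (g ∈ S ↔ h * lt x ∈ S) := by
      intro g hg
      simp only [mem_tr, E, Set.mem_ofPred_eq] at hg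
      obtain ⟨l, hl⟩ : ∃ l, (h⁻¹ * g).toWord = x :: l := by
        rcases hw : (h⁻¹ * g).toWord with _ | ⟨y, l⟩
        · simp [hw] at hg
        · simp [hw] at hg; exact ⟨l, by rw [hg]⟩
      have := this l (hl ▸ isReduced_toWord)
      rw [← hl, mk_toWord] at this
      simpa using this
    exact h2 ((h3 _ h2').2 ((h3 _ h1').1 h1))
  have : {g | cross S (tr g (E x))} ⊆ ⋃ a ∈ V, ⋃ b ∈ V, (fun g => a * g⁻¹) '' Dl (a⁻¹ * b) (E x) := by
    rintro g ⟨⟨g1, h1⟩, ⟨g2, h2⟩, ⟨g3, h3⟩, ⟨g4, h4⟩⟩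
    obtain ⟨a, ha, ha'⟩ := key x g ⟨g1, h1⟩ ⟨g3, h3⟩
    have e : ∀ k, k ∉ tr g (E x) ↔ k ∈ tr (g * lt x) (E (bar x)) := by
      intro k
      rw [← tr_tr, ← E_compl, tr_compl]; rfl
    rw [e] at h2 h4
    obtain ⟨b, hb, hb'⟩ := key (bar x) (g * lt x) ⟨g2, h2⟩ ⟨g4, h4⟩
    rw [← e] at hb'
    simp only [Set.mem_iUnion]
    refine ⟨a, ha, b, hb, g⁻¹ * a, ?_, by simp⟩
    rw [mem_Dl]
    simp only [mem_tr] at ha' hb'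
    simp [mul_assoc, ha', hb']
  refine Set.Finite.subset ?_ this
  exact hV.biUnion fun a _ => hV.biUnion fun b _ => (AI_E x _).image _

/-- twice the weight of the part of the boundary of B inside A -/
noncomputable def w (u : FreeGroup α) (B A : Set (FreeGroup α)) : ℕ :=
  {g | g ∈ Dl u B ∧ g ∈ A}.ncard + {g | g ∈ Dl u B ∧ g * u ∈ A}.ncard

lemma w_mono {u : FreeGroup α} {B A A' : Set (FreeGroup α)} (hB : AI B) (h : A' ⊆ A) :
    w u B A' ≤ w u B A := by
  apply add_le_add
  · exact Set.ncard_le_ncard (fun g hg => ⟨hg.1, h hg.2⟩) ((hB u).subset fun g hg => hg.1)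
  · exact Set.ncard_le_ncard (fun g hg => ⟨hg.1, h hg.2⟩) ((hB u).subset fun g hg => hg.1)

open Classical in
lemma ncard_eq_sum {β : Type*} (T : Finset β) (S : Set β) (h : S ⊆ T) :
    S.ncard = ∑ g ∈ T, if g ∈ S then 1 else 0 := by
  rw [Finset.sum_boole, ← Set.ncard_coe_finset]
  congr 1
  ext g
  simp
  exact fun hg => h hg

lemma w_ineq {u : FreeGroup α} {A B : Set (FreeGroup α)} (hA : AI A) (hB : AI B)
    (h : w u B A ≤ w u A Bᶜ) : c u (A ∩ B) ≤ c u A := by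
  classical
  set T := (hA u).toFinset ∪ (hB u).toFinset
  have hTA : Dl u A ⊆ T := fun g hg => by simp [T, hg]
  have hTB : Dl u B ⊆ T := fun g hg => by simp [T, hg]
  have h0 : Dl u (A ∩ B) ⊆ T := by
    intro g hg
    by_contra h
    have h1 := fun h' => h (hTA h')
    have h2 := fun h' => h (hTB h')
    simp only [mem_Dl, Set.mem_inter_iff] at *
    tauto
  suffices 2 * (Dl u (A ∩ B)).ncard + ({g | g ∈ Dl u A ∧ g ∈ Bᶜ}.ncard +
      {g | g ∈ Dl u A ∧ g * u ∈ Bᶜ}.ncard) ≤ ({g | g ∈ Dl u B ∧ g ∈ A}.ncard +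
      {g | g ∈ Dl u B ∧ g * u ∈ A}.ncard) + 2 * (Dl u A).ncard by
    unfold w at h
    unfold c
    omega
  rw [ncard_eq_sum T {g | g ∈ Dl u B ∧ g ∈ A} (fun g hg => hTB hg.1),
   ncard_eq_sum T {g | g ∈ Dl u B ∧ g * u ∈ A} (fun g hg => hTB hg.1),
   ncard_eq_sum T {g | g ∈ Dl u A ∧ g ∈ Bᶜ} (fun g hg => hTA hg.1),
   ncard_eq_sum T {g | g ∈ Dl u A ∧ g * u ∈ Bᶜ} (fun g hg => hTA hg.1),
   ncard_eq_sum T _ h0, ncard_eq_sum T _ hTA]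
  simp only [Finset.mul_sum, ← Finset.sum_add_distrib]
  apply Finset.sum_le_sum
  intro g _
  simp only [mem_Dl, Set.mem_inter_iff, Set.mem_compl_iff, Set.mem_ofPred_eq]
  by_cases a1 : g ∈ A <;> by_cases a2 : g * u ∈ A <;> by_cases a3 : g ∈ B <;> by_cases a4 : g * u ∈ B <;>
    simp [a1, a2, a3, a4]

lemma w_compl (u : FreeGroup α) (B A : Set (FreeGroup α)) : w u Bᶜ A = w u B A := by
  simp [w, Dl_compl]

end sets
end MP


namespace MP

open FreeGroup hiding map_mul map_inv map_one
set_option linter.unusedSectionVars false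

section wh
variable {α : Type*} [DecidableEq α]

def pw (x : α × Bool) (b : Bool) : FreeGroup α := if b then lt x else 1

/-- Whitehead endomorphism -/
def whF (x : α × Bool) (p : α × Bool → Bool) : FreeGroup α →* FreeGroup α :=
  FreeGroup.lift fun j => if j = x.1 then of j else (pw x (p (j, true)))⁻¹ * of j * pw x (p (j, false))

def whG (x : α × Bool) (p : α × Bool → Bool) : FreeGroup α →* FreeGroup α :=
  FreeGroup.lift fun j => if j = x.1 then of j else pw x (p (j, true)) * of j * (pw x (p (j, false)))⁻¹

lemma lt_true (j : α) : lt (j, true) = of j := rfl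
lemma lt_false (j : α) : lt (j, false) = (of j)⁻¹ := lt_bar (j, true)

lemma map_lt_fix (f : FreeGroup α →* FreeGroup α) (x : α × Bool) (h : f (of x.1) = of x.1) :
    f (lt x) = lt x := by
  rcases x with ⟨a, b⟩
  cases b
  · rw [lt_false, map_inv, h]
  · exact h

lemma map_pw_fix (f : FreeGroup α →* FreeGroup α) (x : α × Bool) (h : f (of x.1) = of x.1) (b : Bool) :
    f (pw x b) = pw x b := by
  cases b
  · simp [pw]
  · simp [pw, map_lt_fix f x h]

lemma whF_fix (x : α × Bool) (p : α × Bool → Bool) : whF x p (of x.1) = of x.1 := by simp [whF]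
lemma whG_fix (x : α × Bool) (p : α × Bool → Bool) : whG x p (of x.1) = of x.1 := by simp [whG]

lemma whF_of (x : α × Bool) (p : α × Bool → Bool) {j : α} (h : j ≠ x.1) :
    whF x p (of j) = (pw x (p (j, true)))⁻¹ * of j * pw x (p (j, false)) := by simp [whF, h]
lemma whG_of (x : α × Bool) (p : α × Bool → Bool) {j : α} (h : j ≠ x.1) :
    whG x p (of j) = pw x (p (j, true)) * of j * (pw x (p (j, false)))⁻¹ := by simp [whG, h]

def whA (x : α × Bool) (p : α × Bool → Bool) : MulAut (FreeGroup α) :=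
  MonoidHom.toMulEquiv (whF x p) (whG x p)
    (by
      ext j
      by_cases h : j = x.1
      · subst h; simp [whF_fix, whG_fix]
      · simp only [MonoidHom.comp_apply, whF_of x p h, map_mul, map_inv, whG_of x p h,
          map_pw_fix _ x (whG_fix x p), MonoidHom.id_apply]
        group)
    (by
      ext j
      by_cases h : j = x.1
      · subst h; simp [whF_fix, whG_fix]
      · simp only [MonoidHom.comp_apply, whF_of x p h, map_mul, map_inv, whG_of x p h,
          map_pw_fix _ x (whF_fix x p), MonoidHom.id_apply]
        group)

lemma whA_apply (x : α × Bool) (p : α × Bool → Bool) (g : FreeGroup α) : whA x p g = whF x p g := rfl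

lemma whA_lt (x : α × Bool) (p : α × Bool → Bool) {y : α × Bool} (h : y.1 ≠ x.1) :
    whA x p (lt y) = (pw x (p y))⁻¹ * lt y * pw x (p (bar y)) := by
  rcases y with ⟨a, b⟩
  rw [whA_apply]
  cases b
  · rw [lt_false, map_inv, whF_of x p h]; simp [bar, mul_assoc]
  · rw [lt_true, whF_of x p h]; rfl

lemma whA_lt_fix (x : α × Bool) (p : α × Bool → Bool) {y : α × Bool} (h : y.1 = x.1) :
    whA x p (lt y) = lt y := by
  rw [whA_apply]
  apply map_lt_fix (whF x p)
  rw [h, whF_fix]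

lemma E_unique (ω : MulAut (FreeGroup α)) (z : α × Bool) (S : Set (FreeGroup α)) (h1 : 1 ∉ S)
    (h : ∀ y g, (g ∉ S ∧ g * ω (lt y) ∈ S) ↔ (y = z ∧ g = 1)) : im ω (E z) = S := by
  have h' : ∀ y g, (g ∈ S ∧ g * ω (lt y) ∉ S) ↔ (y = bar z ∧ g = ω (lt z)) := by
    intro y g
    have := h (bar y) (g * ω (lt y))
    rw [mul_assoc, ← map_mul, lt_mul_bar, map_one, mul_one, and_comm] at this
    rw [this]
    constructor
    · rintro ⟨rfl, h2⟩
      rw [lt_bar, map_inv, bar_bar]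
      exact ⟨rfl, eq_inv_of_mul_eq_one_left h2⟩
    · rintro ⟨rfl, rfl⟩
      rw [← map_mul]; simp
  have key : ∀ l : List (α × Bool), ω (FreeGroup.mk l) ∈ S ↔ FreeGroup.mk l ∈ E z := by
    intro l
    induction l using List.reverseRecOn with
    | nil =>
      rw [← FreeGroup.one_eq_mk, map_one]
      exact iff_of_false h1 (one_notMem_E z)
    | append_singleton l y ih =>
      rw [mk_concat, map_mul]
      have a1 := h y (ω (FreeGroup.mk l))
      have a2 := h' y (ω (FreeGroup.mk l))
      have a3 := E_enter z y (FreeGroup.mk l)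
      have a4 := E_leave z y (FreeGroup.mk l)
      have e1 : ω (FreeGroup.mk l) = 1 ↔ FreeGroup.mk l = 1 := by simp
      have e2 : ω (FreeGroup.mk l) = ω (lt z) ↔ FreeGroup.mk l = lt z := ω.injective.eq_iff
      rw [e1] at a1
      rw [e2] at a2
      clear e1 e2 h h'
      grind
  ext g
  rw [mem_im]
  have := key (ω⁻¹ g).toWord
  rw [mk_toWord] at this
  rw [← this]; simp

/-- union of half spaces -/
def DD (p : α × Bool → Bool) : Set (FreeGroup α) := {g | ∃ q, p q = true ∧ g ∈ E q}

lemma one_notMem_DD (p : α × Bool → Bool) : 1 ∉ DD p := by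
  rintro ⟨q, -, h⟩; exact one_notMem_E q h

lemma lt_mem_DD (p : α × Bool → Bool) (y : α × Bool) : lt y ∈ DD p ↔ p y = true := by
  constructor
  · rintro ⟨q, h, h'⟩; rw [lt_mem_E] at h'; rwa [h']
  · intro h; exact ⟨y, h, lt_mem_E.2 rfl⟩

lemma DD_enter (p : α × Bool → Bool) (y : α × Bool) (g : FreeGroup α) :
    (g ∉ DD p ∧ g * lt y ∈ DD p) ↔ (p y = true ∧ g = 1) := by
  constructor
  · rintro ⟨h1, q, hq, h2⟩
    have : g ∉ E q := fun h => h1 ⟨q, hq, h⟩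
    obtain ⟨rfl, h⟩ := (E_enter q y g).1 ⟨this, h2⟩
    exact ⟨hq, h⟩
  · rintro ⟨h, rfl⟩
    exact ⟨one_notMem_DD p, by rwa [one_mul, lt_mem_DD]⟩

lemma DD_step (p : α × Bool → Bool) (y : α × Bool) (g : FreeGroup α) (h1 : g ≠ 1) (h2 : g * lt y ≠ 1) :
    g * lt y ∈ DD p ↔ g ∈ DD p := by
  have a := DD_enter p y g
  have b := DD_enter p (bar y) (g * lt y)
  rw [mul_assoc, lt_mul_bar, mul_one] at b
  tauto

lemma DD_pw (p : α × Bool → Bool) (x : α × Bool) (h1 : p x = true) (h2 : p (bar x) = false)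
    (b : Bool) (k : FreeGroup α) :
    k * pw x b ∈ DD p ↔ ((k = 1 ∧ b = true) ∨ (k ≠ 1 ∧ k ∈ DD p)) := by
  have h0 := one_notMem_DD p
  by_cases hk : k = 1
  · subst hk
    cases b
    · simp [pw, h0]
    · simp [pw, lt_mem_DD, h1]
  · cases b
    · simp [pw, hk]
    · by_cases hk' : k * lt x = 1
      · have : k = lt (bar x) := by rw [lt_bar]; exact eq_inv_of_mul_eq_one_left hk'
        have h3 : k ∉ DD p := by rw [this, lt_mem_DD, h2]; simp
        simp [pw, hk', h0, h3, hk]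
      · simp [pw, hk, DD_step p x k hk hk']

lemma whA_DD (x : α × Bool) (p : α × Bool → Bool) (h1 : p x = true) (h2 : p (bar x) = false) :
    im (whA x p) (E x) = DD p := by
  apply E_unique _ _ _ (one_notMem_DD p)
  intro y g
  by_cases hy : y.1 = x.1
  · rw [whA_lt_fix x p hy, DD_enter]
    have : y = x ∨ y = bar x := by
      rcases x with ⟨a, b⟩; rcases y with ⟨c, d⟩
      simp only at hy; subst hy
      cases b <;> cases d <;> simp [bar]
    rcases this with rfl | rfl
    · simp [h1]
    · simp [h2, bar_ne]
  · have hne : y ≠ x := fun h => hy (by rw [h])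
    rw [whA_lt x p hy]
    simp only [hne, false_and, iff_false, not_and, not_not]
    suffices g ∈ DD p ↔ g * ((pw x (p y))⁻¹ * lt y * pw x (p (bar y))) ∈ DD p by tauto
    obtain ⟨k, rfl⟩ : ∃ k, g = k * pw x (p y) := ⟨g * (pw x (p y))⁻¹, by simp⟩
    have : k * pw x (p y) * ((pw x (p y))⁻¹ * lt y * pw x (p (bar y))) = (k * lt y) * pw x (p (bar y)) := by
      group
    rw [this, DD_pw p x h1 h2, DD_pw p x h1 h2]
    by_cases hk : k = 1
    · subst hk
      have : lt y ≠ 1 := by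
        intro h; have := congrArg toWord h; simp at this
      simp [this, lt_mem_DD]
    · by_cases hk' : k * lt y = 1
      · have : k = lt (bar y) := by rw [lt_bar]; exact eq_inv_of_mul_eq_one_left hk'
        have h3 : k ∈ DD p ↔ p (bar y) = true := by rw [this, lt_mem_DD]
        simp [hk', h3, hk]
      · simp [hk, hk', DD_step p y k hk hk']

lemma whA_other (x : α × Bool) (p : α × Bool → Bool) (z : α × Bool) (hz : z.1 ≠ x.1) :
    im (whA x p) (E z) = tr (pw x (p z))⁻¹ (E z) := by
  have nz : ∀ y : α × Bool, y.1 = x.1 → ∀ g, g * lt y ∈ E z ↔ g ∈ E z := by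
    intro y hy g
    have : g ∉ Dl (lt y) (E z) := by
      rw [Dl_lt_E]
      rintro (⟨rfl, -⟩ | ⟨rfl, -⟩)
      · exact hz hy
      · exact hz hy
    rw [mem_Dl, not_not] at this
    exact this.symm
  have npw : ∀ b g, g * pw x b ∈ E z ↔ g ∈ E z := by
    intro b g
    cases b
    · simp [pw]
    · simpa [pw] using nz x rfl g
  apply E_unique
  · rw [mem_tr, inv_inv, mul_one]
    have := npw (p z) 1
    rw [one_mul] at this
    rw [this]; exact one_notMem_E z
  · intro y g
    simp only [mem_tr, inv_inv]
    by_cases hy : y.1 = x.1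
    · have hne : y ≠ z := fun h => hz (by rw [← h, hy])
      rw [whA_lt_fix x p hy, ← mul_assoc, nz y hy]
      simp [hne]
    · rw [whA_lt x p hy]
      obtain ⟨k, rfl⟩ : ∃ k, g = (pw x (p z))⁻¹ * k * pw x (p y) :=
        ⟨pw x (p z) * g * (pw x (p y))⁻¹, by simp [mul_assoc]⟩
      have e1 : pw x (p z) * ((pw x (p z))⁻¹ * k * pw x (p y)) = k * pw x (p y) := by group
      have e2 : pw x (p z) * ((pw x (p z))⁻¹ * k * pw x (p y) * ((pw x (p y))⁻¹ * lt y * pw x (p (bar y))))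
        = k * lt y * pw x (p (bar y)) := by group
      rw [e1, e2, npw, npw, E_enter]
      constructor
      · rintro ⟨rfl, rfl⟩; simp
      · rintro ⟨rfl, h⟩
        refine ⟨rfl, ?_⟩
        have : k = pw x (p y) * ((pw x (p y))⁻¹ * k * pw x (p y)) * (pw x (p y))⁻¹ := by group
        rw [this, h]; simp

def Wh (α : Type*) [DecidableEq α] : Set (MulAut (FreeGroup α)) :=
  Set.range fun q : (α × Bool) × (α × Bool → Bool) => whA q.1 q.2

lemma Wh_finite [Fintype α] : (Wh α).Finite := Set.finite_range _

end wh
end MP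


namespace MP

open FreeGroup hiding map_mul map_inv map_one
set_option linter.unusedSectionVars false

section surg
variable {α : Type*} [DecidableEq α]

lemma nest_aux (s : List (α × Bool)) (l : α × Bool) (h : FreeGroup.IsReduced (s ++ [l])) :
    ∃ q, tr (FreeGroup.mk s) (E l) ⊆ E q := by
  obtain ⟨q, t, hq⟩ : ∃ q t, s ++ [l] = q :: t := by
    cases s with
    | nil => exact ⟨l, [], rfl⟩
    | cons a s => exact ⟨a, s ++ [l], rfl⟩
  refine ⟨q, fun g hg => ?_⟩
  rw [mem_tr, cyl s l h, hq] at hg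
  obtain ⟨r, hr⟩ := hg
  simp only [E, Set.mem_ofPred_eq]
  rw [← hr]; rfl

lemma nest (h : FreeGroup α) (l : α × Bool) :
    ∃ q, tr h (E l) ⊆ E q ∨ (tr h (E l))ᶜ ⊆ E q := by
  by_cases hr : FreeGroup.IsReduced (h.toWord ++ [l])
  · obtain ⟨q, hq⟩ := nest_aux _ _ hr
    rw [mk_toWord] at hq
    exact ⟨q, Or.inl hq⟩
  · have h0 : FreeGroup.IsReduced h.toWord := isReduced_toWord
    rcases List.eq_nil_or_concat h.toWord with hn | ⟨s, y, hs⟩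
    · rw [hn] at hr; simp at hr
    · rw [List.concat_eq_append] at hs
      rw [hs] at hr h0
      have : y = bar l := by
        by_contra hy
        apply hr
        rw [red_concat]
        refine ⟨?_, h0⟩
        intro z hz
        simp at hz
        subst hz
        exact hy
      subst this
      obtain ⟨q, hq⟩ := nest_aux _ _ h0
      refine ⟨q, Or.inr ?_⟩
      rw [← tr_compl, E_compl, tr_tr]
      have : h * lt l = FreeGroup.mk s := by
        rw [← mk_toWord (x := h), hs, mk_concat, mul_assoc, bar_mul_lt, mul_one]
      rw [this]; exact hq

lemma E_nocross (k l : α × Bool) (h : FreeGroup α) : ¬ cross (E k) (tr h (E l)) := by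
  obtain ⟨q, hq⟩ := nest h l
  have key : ∀ S : Set (FreeGroup α), S ⊆ E q → ¬ cross (E k) S := by
    rintro S hS ⟨⟨a, ha, ha'⟩, -, ⟨b, hb, hb'⟩, -⟩
    have e : k = q := by
      exact E_disj ha (hS ha')
    subst e
    exact hb (hS hb')
  rcases hq with hq | hq
  · exact key _ hq
  · rw [← cross_compl_right]; exact key _ hq

/-- half-spaces -/
def HS (φ : MulAut (FreeGroup α)) (A : Set (FreeGroup α)) : Prop :=
  ∃ h l, A = tr h (im φ (E l))

lemma HS.tr {φ : MulAut (FreeGroup α)} {A} (h : HS φ A) (k) : HS φ (tr k A) := by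
  obtain ⟨h, l, rfl⟩ := h
  exact ⟨k * h, l, tr_tr _ _ _⟩

lemma HS.compl {φ : MulAut (FreeGroup α)} {A} (h : HS φ A) : HS φ Aᶜ := by
  obtain ⟨h, l, rfl⟩ := h
  refine ⟨h * φ (lt l), bar l, ?_⟩
  rw [← tr_compl, ← im_compl, E_compl, im_tr, tr_tr]

lemma HS.im {φ : MulAut (FreeGroup α)} {A} (h : HS φ A) (θ : MulAut (FreeGroup α)) :
    HS (θ * φ) (im θ A) := by
  obtain ⟨h, l, rfl⟩ := h
  exact ⟨θ h, l, by rw [im_tr, im_im]⟩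

lemma HS.AI {φ : MulAut (FreeGroup α)} {A} (h : HS φ A) : AI A := by
  obtain ⟨h, l, rfl⟩ := h
  exact ((AI_E l).im φ).tr h

lemma HS_nocross {φ : MulAut (FreeGroup α)} {A B} (hA : HS φ A) (hB : HS φ B) : ¬ cross A B := by
  obtain ⟨h, l, rfl⟩ := hA
  obtain ⟨k, m, rfl⟩ := hB
  rw [← cross_tr (h := h⁻¹), tr_tr, tr_tr, inv_mul_cancel, tr_one, ← cross_im (φ := φ⁻¹), im_tr,
    im_im, im_im, inv_mul_cancel, im_one, im_one]
  exact E_nocross _ _ _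

lemma w_tr (u k : FreeGroup α) (A B : Set (FreeGroup α)) : w u (tr k B) (tr k A) = w u B A := by
  unfold w
  have e1 : {g | g ∈ Dl u (tr k B) ∧ g ∈ tr k A} = (fun g => k * g) '' {g | g ∈ Dl u B ∧ g ∈ A} := by
    ext g
    simp only [Set.mem_image, Set.mem_ofPred_eq, mem_Dl, mem_tr, ← mul_assoc]
    constructor
    · intro h; exact ⟨k⁻¹ * g, h, by simp⟩
    · rintro ⟨g, h, rfl⟩; simpa using h
  have e2 : {g | g ∈ Dl u (tr k B) ∧ g * u ∈ tr k A} = (fun g => k * g) '' {g | g ∈ Dl u B ∧ g * u ∈ A} := by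
    ext g
    simp only [Set.mem_image, Set.mem_ofPred_eq, mem_Dl, mem_tr, ← mul_assoc]
    constructor
    · intro h; exact ⟨k⁻¹ * g, h, by simp⟩
    · rintro ⟨g, h, rfl⟩; simpa using h
  rw [e1, e2, Set.ncard_image_of_injective _ (mul_right_injective k),
    Set.ncard_image_of_injective _ (mul_right_injective k)]

lemma w_im (u : FreeGroup α) (φ : MulAut (FreeGroup α)) (A B : Set (FreeGroup α)) :
    w u (im φ B) (im φ A) = w (φ⁻¹ u) B A := by
  unfold w
  have e1 : {g | g ∈ Dl u (im φ B) ∧ g ∈ im φ A} = φ '' {g | g ∈ Dl (φ⁻¹ u) B ∧ g ∈ A} := by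
    ext g
    simp only [Set.mem_image, Set.mem_ofPred_eq, mem_Dl, mem_im, map_mul]
    constructor
    · intro h; exact ⟨φ⁻¹ g, h, by simp⟩
    · rintro ⟨g, h, rfl⟩; simpa using h
  have e2 : {g | g ∈ Dl u (im φ B) ∧ g * u ∈ im φ A} = φ '' {g | g ∈ Dl (φ⁻¹ u) B ∧ g * (φ⁻¹ u) ∈ A} := by
    ext g
    simp only [Set.mem_image, Set.mem_ofPred_eq, mem_Dl, mem_im, map_mul]
    constructor
    · intro h; exact ⟨φ⁻¹ g, h, by simp⟩
    · rintro ⟨g, h, rfl⟩; simpa using h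
  rw [e1, e2, Set.ncard_image_of_injective _ φ.injective,
    Set.ncard_image_of_injective _ φ.injective]

variable [Fintype α]

/-- number of half-spaces of ψ crossing S -/
noncomputable def N (ψ : MulAut (FreeGroup α)) (S : Set (FreeGroup α)) : ℕ :=
  ∑ k, {g | cross S (tr g (im ψ (E (k, true))))}.ncard

lemma finite_cross' {S : Set (FreeGroup α)} (hS : AI S) (ψ : MulAut (FreeGroup α)) (x : α × Bool) :
    {g | cross S (tr g (im ψ (E x)))}.Finite := by
  have := (finite_cross (hS.im ψ⁻¹) x).image ψ
  refine this.subset fun g hg => ?_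
  refine ⟨ψ⁻¹ g, ?_, by simp⟩
  simp only [Set.mem_ofPred_eq] at hg ⊢
  rw [← cross_im (φ := ψ⁻¹), im_tr, im_im, inv_mul_cancel, im_one] at hg
  exact hg

lemma N_tr (ψ : MulAut (FreeGroup α)) (k) (S : Set (FreeGroup α)) : N ψ (tr k S) = N ψ S := by
  unfold N
  refine Finset.sum_congr rfl fun i _ => ?_
  symm
  rw [← Set.ncard_image_of_injective _ (mul_right_injective k)]
  symm
  congr 1
  ext g
  simp only [Set.mem_image, Set.mem_ofPred_eq]
  constructor
  · intro h
    refine ⟨k⁻¹ * g, ?_, by simp⟩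
    rwa [← cross_tr (h := k), tr_tr, mul_inv_cancel_left]
  · rintro ⟨g, h, rfl⟩
    rwa [← cross_tr (h := k), tr_tr] at h

lemma N_compl (ψ : MulAut (FreeGroup α)) (S : Set (FreeGroup α)) : N ψ Sᶜ = N ψ S := by
  simp only [N, cross_compl_left]

lemma N_lt (ψ : MulAut (FreeGroup α)) {A D B : Set (FreeGroup α)} (hA : AI A)
    (h1 : ∀ C, HS ψ C → cross D C → cross A C) (hB : HS ψ B) (h2 : cross A B) (h3 : ¬ cross D B) :
    N ψ D < N ψ A := by
  obtain ⟨g, k, h4, h5⟩ : ∃ g k, cross A (tr g (im ψ (E (k, true)))) ∧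
      ¬ cross D (tr g (im ψ (E (k, true)))) := by
    obtain ⟨h, ⟨k, b⟩, rfl⟩ := hB
    cases b
    · refine ⟨h * ψ (lt (k, false)), k, ?_⟩
      have : tr (h * ψ (lt (k, false))) (im ψ (E (k, true))) = (tr h (im ψ (E (k, false))))ᶜ := by
        rw [← tr_compl, ← im_compl, E_compl, im_tr, tr_tr]; rfl
      rw [this, cross_compl_right, cross_compl_right]
      exact ⟨h2, h3⟩
    · exact ⟨h, k, h2, h3⟩
  unfold N
  apply Finset.sum_lt_sum
  · intro i _
    exact Set.ncard_le_ncard (fun g hg => h1 _ ⟨g, _, rfl⟩ hg) (finite_cross' hA ψ _)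
  · refine ⟨k, Finset.mem_univ _, ?_⟩
    apply Set.ncard_lt_ncard _ (finite_cross' hA ψ _)
    refine ⟨fun g hg => h1 _ ⟨g, _, rfl⟩ hg, fun hh => h5 (hh h4)⟩

/-- intersection number -/
noncomputable def Ix (φ ψ : MulAut (FreeGroup α)) : ℕ := ∑ i, N ψ (im φ (E (i, true)))

lemma Ix_symm (φ ψ : MulAut (FreeGroup α)) : Ix φ ψ = Ix ψ φ := by
  unfold Ix N
  rw [Finset.sum_comm]
  refine Finset.sum_congr rfl fun i _ => Finset.sum_congr rfl fun j _ => ?_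
  rw [← Set.ncard_image_of_injective _ inv_injective]
  congr 1
  ext g
  simp only [Set.mem_image, Set.mem_ofPred_eq]
  have : ∀ g, cross (im φ (E (j, true))) (tr g (im ψ (E (i, true)))) ↔
      cross (im ψ (E (i, true))) (tr g⁻¹ (im φ (E (j, true)))) := by
    intro g
    rw [← cross_tr (h := g⁻¹), tr_tr, inv_mul_cancel, tr_one, cross_comm]
  constructor
  · rintro ⟨g, h, rfl⟩; rwa [← this]
  · intro h; exact ⟨g⁻¹, by rwa [this, inv_inv], by simp⟩

lemma Ix_im (θ φ ψ : MulAut (FreeGroup α)) : Ix (θ * φ) (θ * ψ) = Ix φ ψ := by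
  unfold Ix N
  refine Finset.sum_congr rfl fun i _ => Finset.sum_congr rfl fun j _ => ?_
  symm
  rw [← Set.ncard_image_of_injective _ θ.injective]
  symm
  congr 1
  ext g
  simp only [Set.mem_image, Set.mem_ofPred_eq, ← im_im]
  constructor
  · intro h
    refine ⟨θ⁻¹ g, ?_, by simp⟩
    rw [← cross_im (φ := θ), im_tr]
    simpa using h
  · rintro ⟨g, h, rfl⟩
    rwa [← cross_im (φ := θ), im_tr] at h

lemma Len_eq (φ : MulAut (FreeGroup α)) (u : FreeGroup α) :
    ∑ i, c u (im φ (E (i, true))) = (φ⁻¹ u).norm := by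
  simp only [c_im, sum_c]

lemma inv_E (F : Set (FreeGroup α) → ℕ) (h1 : ∀ k S, F (tr k S) = F S) (h2 : ∀ S, F Sᶜ = F S)
    (φ : MulAut (FreeGroup α)) (x : α × Bool) :
    F (im φ (E x)) = F (im φ (E (x.1, true))) := by
  rcases x with ⟨a, b⟩
  cases b
  · rw [← h2, ← im_compl, E_compl, im_tr, h1]; rfl
  · rfl

end surg
end MP


namespace MP

open FreeGroup hiding map_mul map_inv map_one
set_option linter.unusedSectionVars false

section surg2
variable {α : Type*} [DecidableEq α] [Fintype α]

lemma bar_fst (x : α × Bool) : (bar x).1 = x.1 := rfl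

/-- sums after surgery -/
lemma surg_sum (F : Set (FreeGroup α) → ℕ) (h1 : ∀ k S, F (tr k S) = F S) (h2 : ∀ S, F Sᶜ = F S)
    (x : α × Bool) (p : α × Bool → Bool) :
    (∑ i, F (im (whA x p) (E (i, true)))) + F (E x) = (∑ i, F (E (i, true))) + F (im (whA x p) (E x)) := by
  have e : F (E x) = F (E (x.1, true)) := by
    have := inv_E F h1 h2 1 x
    simpa [im_one] using this
  rw [e, inv_E F h1 h2 (whA x p) x]
  rw [← Finset.add_sum_erase _ _ (Finset.mem_univ x.1),
    ← Finset.add_sum_erase _ (fun i => F (E (i, true))) (Finset.mem_univ x.1)]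
  have : ∑ i ∈ Finset.univ.erase x.1, F (im (whA x p) (E (i, true))) =
      ∑ i ∈ Finset.univ.erase x.1, F (E (i, true)) := by
    refine Finset.sum_congr rfl fun i hi => ?_
    rw [whA_other x p (i, true) (Finset.ne_of_mem_erase hi), h1]
  omega

lemma surgery_core (ψ : MulAut (FreeGroup α)) (u : FreeGroup α) (x : α × Bool) (p : α × Bool → Bool)
    (D : Set (FreeGroup α)) (hD : im (whA x p) (E x) = D ∨ im (whA x p) (E x) = Dᶜ)
    (h1 : c u D ≤ c u (E x)) (h2 : N ψ D < N ψ (E x)) :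
    ∃ ω ∈ Wh α, (ω⁻¹ u).norm ≤ u.norm ∧ Ix ω ψ < Ix 1 ψ := by
  refine ⟨whA x p, ⟨(x, p), rfl⟩, ?_, ?_⟩
  · have := surg_sum (c u) (fun k S => c_tr u k S) (c_compl u) x p
    have e : c u (im (whA x p) (E x)) = c u D := by
      rcases hD with h | h <;> rw [h]
      rw [c_compl]
    rw [← Len_eq, ← sum_c u]
    omega
  · have := surg_sum (N ψ) (N_tr ψ) (N_compl ψ) x p
    have e : N ψ (im (whA x p) (E x)) = N ψ D := by
      rcases hD with h | h <;> rw [h]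
      rw [N_compl]
    unfold Ix
    simp only [im_one]
    omega

lemma surgery_aux (ψ : MulAut (FreeGroup α)) (u : FreeGroup α) (x : α × Bool) (B : Set (FreeGroup α))
    (hB : HS ψ B) (hc : cross (E (bar x))ᶜ B) (hz : ∀ z, z ≠ bar x → ¬ cross (E z) B)
    (hx : E x ⊆ B) (h2 : w u B (E (bar x))ᶜ ≤ w u (E (bar x))ᶜ Bᶜ) :
    ∃ ω ∈ Wh α, (ω⁻¹ u).norm ≤ u.norm ∧ Ix ω ψ < Ix 1 ψ := by
  classical
  have hz' : ∀ z, z ≠ bar x → E z ⊆ B ∨ E z ⊆ Bᶜ := by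
    intro z hzx
    by_contra! hcon
    obtain ⟨ha, hb⟩ := hcon
    rw [Set.not_subset] at ha hb
    obtain ⟨a, ha1, ha2⟩ := ha
    obtain ⟨b, hb1, hb2⟩ := hb
    rw [Set.mem_compl_iff, not_not] at hb2
    apply hz z hzx
    obtain ⟨-, -, ⟨g3, h3, h3'⟩, ⟨g4, h4, h4'⟩⟩ := hc
    rw [Set.mem_compl_iff, not_not] at h3 h4
    exact ⟨⟨b, hb1, hb2⟩, ⟨a, ha1, ha2⟩, ⟨g3, fun h => hzx (E_disj h h3), h3'⟩,
      ⟨g4, fun h => hzx (E_disj h h4), h4'⟩⟩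
  set A := (E (bar x))ᶜ with hA
  have hAA : HS 1 A := by
    have : HS 1 (E (bar x)) := ⟨1, bar x, by rw [tr_one, im_one]⟩
    exact this.compl
  have k1 : c u (A ∩ B) ≤ c u A := w_ineq hAA.AI hB.AI h2
  have k2 : N ψ (A ∩ B) < N ψ A := by
    apply N_lt ψ hAA.AI _ hB hc
    · rintro ⟨-, ⟨g, h, h'⟩, -⟩
      exact h' h.2
    · intro C hC hDC
      have hBC := HS_nocross hB hC
      obtain ⟨⟨a, ha, ha'⟩, ⟨b, hb, hb'⟩, ⟨d, hd, hd'⟩, ⟨e, he, he'⟩⟩ := hDC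
      obtain ⟨-, -, ⟨g3, h3, h3'⟩, ⟨g4, h4, h4'⟩⟩ := hc
      have hor : (∀ g, g ∉ B → g ∉ C) ∨ (∀ g, g ∉ B → g ∈ C) := by
        by_contra! hcon
        obtain ⟨⟨g, h, h'⟩, ⟨k, hk, hk'⟩⟩ := hcon
        exact hBC ⟨⟨a, ha.2, ha'⟩, ⟨b, hb.2, hb'⟩, ⟨g, h, h'⟩, ⟨k, hk, hk'⟩⟩
      refine ⟨⟨a, ha.1, ha'⟩, ⟨b, hb.1, hb'⟩, ?_, ?_⟩
      · rcases hor with hor | hor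
        · refine ⟨d, fun hdA => ?_, hd'⟩
          by_cases hdB : d ∈ B
          · exact hd ⟨hdA, hdB⟩
          · exact hor d hdB hd'
        · exact ⟨g4, h4, hor _ h4'⟩
      · rcases hor with hor | hor
        · exact ⟨g4, h4, hor _ h4'⟩
        · refine ⟨e, fun hdA => ?_, he'⟩
          by_cases hdB : e ∈ B
          · exact he ⟨hdA, hdB⟩
          · exact he' (hor e hdB)
  rw [hA, c_compl] at k1
  rw [hA, N_compl] at k2
  have cx : c u (E (bar x)) = c u (E x) := by
    have h := inv_E (c u) (fun k S => c_tr u k S) (c_compl u) 1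
    have a := h x
    have b := h (bar x)
    simp only [im_one] at a b
    rw [a, b]; rfl
  have nx : N ψ (E (bar x)) = N ψ (E x) := by
    have h := inv_E (N ψ) (N_tr ψ) (N_compl ψ) 1
    have a := h x
    have b := h (bar x)
    simp only [im_one] at a b
    rw [a, b]; rfl
  rw [← hA] at k1 k2
  have ltx : lt x ∈ E x := lt_mem_E.2 rfl
  have memS : ∀ g : FreeGroup α, g ≠ 1 → ∃ q, g ∈ E q := fun g hg => (mem_some_E g).resolve_left hg
  by_cases h1 : (1 : FreeGroup α) ∈ B
  · apply surgery_core ψ u (bar x) (fun q => decide (q = bar x ∨ E q ⊆ Bᶜ)) (A ∩ B) (Or.inr ?_) k1 k2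
    rw [whA_DD]
    · ext g
      simp only [DD, decide_eq_true_eq, Set.mem_ofPred_eq, Set.mem_compl_iff, Set.mem_inter_iff, not_and, hA]
      constructor
      · rintro ⟨q, rfl | hq, hg⟩ h
        · exact absurd hg h
        · exact hq hg
      · intro h
        by_cases hg : g ∈ E (bar x)
        · exact ⟨bar x, Or.inl rfl, hg⟩
        · obtain ⟨q, hq⟩ := memS g (fun h' => h hg (h' ▸ h1))
          refine ⟨q, Or.inr ?_, hq⟩
          rcases hz' q (fun h' => hg (h' ▸ hq)) with h' | h'
          · exact absurd (h' hq) (h hg)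
          · exact h'
    · simp
    · rw [bar_bar]
      simp only [decide_eq_false_iff_not, not_or]
      exact ⟨(bar_ne x).symm, fun h => h ltx (hx ltx)⟩
  · apply surgery_core ψ u x (fun q => decide (q ≠ bar x ∧ E q ⊆ B)) (A ∩ B) (Or.inl ?_)
      (cx ▸ k1) (nx ▸ k2)
    rw [whA_DD]
    · ext g
      simp only [DD, decide_eq_true_eq, Set.mem_ofPred_eq, Set.mem_compl_iff, Set.mem_inter_iff, hA]
      constructor
      · rintro ⟨q, ⟨hq1, hq⟩, hg⟩
        exact ⟨fun h => hq1 (E_disj hg h), hq hg⟩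
      · rintro ⟨hg, h⟩
        obtain ⟨q, hq⟩ := memS g (fun h' => h1 (h' ▸ h))
        have hne : q ≠ bar x := (fun h' => hg (h' ▸ hq))
        refine ⟨q, ⟨hne, ?_⟩, hq⟩
        rcases hz' q hne with h' | h'
        · exact h'
        · exact absurd h (h' hq)
    · simp [hx, (bar_ne x).symm]
    · simp

lemma surgery (ψ : MulAut (FreeGroup α)) (u : FreeGroup α) (x : α × Bool) (B : Set (FreeGroup α))
    (hB : HS ψ B) (hc : cross (E (bar x))ᶜ B) (hz : ∀ z, z ≠ bar x → ¬ cross (E z) B)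
    (h1 : w u B (E (bar x))ᶜ ≤ w u (E (bar x))ᶜ B)
    (h2 : w u B (E (bar x))ᶜ ≤ w u (E (bar x))ᶜ Bᶜ) :
    ∃ ω ∈ Wh α, (ω⁻¹ u).norm ≤ u.norm ∧ Ix ω ψ < Ix 1 ψ := by
  have : E x ⊆ B ∨ E x ⊆ Bᶜ := by
    by_contra! hcon
    obtain ⟨ha, hb⟩ := hcon
    rw [Set.not_subset] at ha hb
    obtain ⟨a, ha1, ha2⟩ := ha
    obtain ⟨b, hb1, hb2⟩ := hb
    rw [Set.mem_compl_iff, not_not] at hb2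
    have hzx := (bar_ne x).symm
    apply hz x hzx
    obtain ⟨-, -, ⟨g3, h3, h3'⟩, ⟨g4, h4, h4'⟩⟩ := hc
    rw [Set.mem_compl_iff, not_not] at h3 h4
    exact ⟨⟨b, hb1, hb2⟩, ⟨a, ha1, ha2⟩, ⟨g3, fun h => hzx (E_disj h h3), h3'⟩,
      ⟨g4, fun h => hzx (E_disj h h4), h4'⟩⟩
  rcases this with h | h
  · exact surgery_aux ψ u x B hB hc hz h h2
  · apply surgery_aux ψ u x Bᶜ hB.compl (by rwa [cross_compl_right]) _ h (by rwa [w_compl, compl_compl])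
    intro z hz1
    rw [cross_compl_right]; exact hz z hz1

lemma half_step (φ ψ : MulAut (FreeGroup α)) (u : FreeGroup α) (A B : Set (FreeGroup α))
    (hA : HS φ A) (hB : HS ψ B) (hc : cross A B)
    (hmin : ∀ A' B', HS φ A' → HS ψ B' → cross A' B' → w u B A ≤ w u A' B') :
    ∃ ω ∈ Wh α, ((φ * ω)⁻¹ u).norm ≤ (φ⁻¹ u).norm ∧ Ix (φ * ω) ψ < Ix φ ψ := by
  have hfin : {A' | HS φ A' ∧ cross A' B ∧ A' ⊆ A}.Finite := by
    have : (⋃ l, (fun g => tr g (im φ (E l))) '' {g | cross B (tr g (im φ (E l)))}).Finite :=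
      Set.finite_iUnion fun l => (finite_cross' hB.AI φ l).image _
    refine this.subset ?_
    rintro A' ⟨⟨h, l, rfl⟩, h2, h3⟩
    simp only [Set.mem_iUnion]
    exact ⟨l, h, cross_symm h2, rfl⟩
  obtain ⟨A', ⟨hA', hc', hsub⟩, hA'min⟩ := hfin.exists_minimal ⟨A, hA, hc, subset_rfl⟩
  have hw : w u B A' ≤ w u B A := w_mono hB.AI hsub
  obtain ⟨h, x, rfl⟩ := hA'
  set k := h * φ (lt x)
  have hk : tr h (im φ (E x)) = tr k (im φ (E (bar x))ᶜ) := by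
    rw [E_compl, im_tr, tr_tr, bar_bar]
    congr 1
    rw [lt_bar, map_inv]; simp [k]
  set B0 := im φ⁻¹ (tr k⁻¹ B) with hB0
  have key2 : tr k (im φ B0) = B := by
    rw [hB0, im_im, mul_inv_cancel, im_one, tr_tr, mul_inv_cancel, tr_one]
  have wk : ∀ S, w (φ⁻¹ u) B0 S = w u B (tr k (im φ S)) := by
    intro S
    conv_rhs => rw [← key2, w_tr, w_im]
  have wk' : ∀ S, w (φ⁻¹ u) S B0 = w u (tr k (im φ S)) B := by
    intro S
    conv_rhs => rw [← key2, w_tr, w_im]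
  have ck : ∀ S, cross S B0 ↔ cross (tr k (im φ S)) B := by
    intro S
    conv_rhs => rw [← key2, cross_tr, cross_im]
  rw [hk] at hA'min hc' hsub hw
  have hHS : ∀ z, HS φ (tr k (im φ (E z))) := fun z => ⟨k, z, rfl⟩
  have hHS' : HS φ (tr k (im φ (E (bar x))ᶜ)) := by
    rw [← hk]; exact ⟨h, x, rfl⟩
  obtain ⟨ω, hω, h1, h2⟩ := surgery (φ⁻¹ * ψ) (φ⁻¹ u) x B0 ((hB.tr _).im _) ((ck _).2 hc')
    (by
      intro z hz hcr
      rw [ck] at hcr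
      have hss : tr k (im φ (E z)) ⊆ tr k (im φ (E (bar x))ᶜ) := by
        intro g hg hg'
        exact hz (E_disj hg hg')
      have := hA'min ⟨hHS z, hcr, hss.trans hsub⟩ hss
      have h1 : k ∈ tr k (im φ (E (bar x))ᶜ) := by
        simp [one_notMem_E]
      have h2 := this h1
      simp [one_notMem_E] at h2)
    (by rw [wk, wk']; exact hw.trans (hmin _ _ hHS' hB hc'))
    (by
      rw [wk]
      have e : w (φ⁻¹ u) (E (bar x))ᶜ B0ᶜ = w u (tr k (im φ (E (bar x))ᶜ)) Bᶜ := by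
        have : Bᶜ = tr k (im φ B0ᶜ) := by rw [im_compl, tr_compl, key2]
        rw [this, w_tr, w_im]
      rw [e]
      exact hw.trans (hmin _ _ hHS' hB.compl (by rwa [cross_compl_right])))
  refine ⟨ω, hω, ?_, ?_⟩
  · rw [mul_inv_rev]; exact h1
  · rw [← Ix_im φ⁻¹, ← Ix_im φ⁻¹ φ ψ, inv_mul_cancel, inv_mul_cancel_left]; exact h2

lemma step (φ ψ : MulAut (FreeGroup α)) (u : FreeGroup α) 
    (hex : ∃ A B, HS φ A ∧ HS ψ B ∧ cross A B) :
    (∃ ω ∈ Wh α, ((φ * ω)⁻¹ u).norm ≤ (φ⁻¹ u).norm ∧ Ix (φ * ω) ψ < Ix φ ψ) ∨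
    (∃ ω ∈ Wh α, ((ψ * ω)⁻¹ u).norm ≤ (ψ⁻¹ u).norm ∧ Ix φ (ψ * ω) < Ix φ ψ) := by
  classical
  have hex' : ∃ m A B, HS φ A ∧ HS ψ B ∧ cross A B ∧ (m = w u B A ∨ m = w u A B) := by
    obtain ⟨A, B, h1, h2, h3⟩ := hex
    exact ⟨_, A, B, h1, h2, h3, Or.inl rfl⟩
  have hmin := fun m h => Nat.find_min' hex' (m := m) h
  obtain ⟨A, B, h1, h2, h3, h4⟩ := Nat.find_spec hex'
  rcases h4 with h4 | h4
  · left
    apply half_step φ ψ u A B h1 h2 h3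
    intro A' B' a b d
    rw [← h4]
    exact hmin _ ⟨A', B', a, b, d, Or.inr rfl⟩
  · right
    obtain ⟨ω, hω, h5, h6⟩ := half_step ψ φ u B A h2 h1 (cross_symm h3) (by
      intro A' B' a b d
      rw [← h4]
      exact hmin _ ⟨B', A', b, a, cross_symm d, Or.inl rfl⟩)
    refine ⟨ω, hω, h5, ?_⟩
    rw [Ix_symm, Ix_symm φ ψ]; exact h6

end surg2
end MP


namespace MP

open FreeGroup hiding map_mul map_inv map_one
set_option linter.unusedSectionVars false

section peak
variable {α : Type*} [DecidableEq α] [Fintype α]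

lemma ball_finite (R : ℕ) : {g : FreeGroup α | g.norm ≤ R}.Finite := by
  have h := List.finite_length_le (α × Bool) R
  exact h.preimage (f := fun g : FreeGroup α => g.toWord) toWord_injective.injOn

/-- automorphisms whose half-spaces do not cross the standard ones -/
def Om0 (α : Type*) [DecidableEq α] : Set (MulAut (FreeGroup α)) :=
  {ω | ∀ A B, HS 1 A → HS ω B → ¬ cross A B}

lemma norm_lt (y : α × Bool) : (lt y).norm = 1 := by simp [FreeGroup.norm, toWord_lt]

lemma om0_dist {ω : MulAut (FreeGroup α)} (h : ω ∈ Om0 α) {B} (hB : HS ω B) (y : α × Bool)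
    {g0 g : FreeGroup α} (h0 : g0 ∈ Dl (lt y) B) (h1 : g ∈ Dl (lt y) B) : (g0⁻¹ * g).norm ≤ 2 := by
  by_contra hn
  push Not at hn
  obtain ⟨l1, l2, t, ht⟩ : ∃ l1 l2 t, (g0⁻¹ * g).toWord = l1 :: l2 :: t := by
    unfold FreeGroup.norm at hn
    rcases hx : (g0⁻¹ * g).toWord with _ | ⟨a, _ | ⟨b, t⟩⟩
    · simp [hx] at hn
    · simp [hx] at hn
    · exact ⟨a, b, t, rfl⟩
  have hred : FreeGroup.IsReduced ([l1] ++ [l2]) := by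
    have := isReduced_toWord (x := g0⁻¹ * g)
    rw [ht] at this
    exact reduced_append_left (l := [l1, l2]) (m := t) this
  have hC := cyl [l1] l2 hred
  have hC1 : lt l1 = FreeGroup.mk [l1] := rfl
  rw [← hC1] at hC
  set C := tr (g0 * lt l1) (E l2) with hCd
  have hmem : ∀ k, k ∈ C ↔ [l1, l2] <+: (g0⁻¹ * k).toWord := by
    intro k
    rw [hCd, mem_tr, mul_inv_rev, mul_assoc, hC]; rfl
  have gC : g ∈ C := by
    rw [hmem, ht]; exact ⟨t, rfl⟩
  have gyC : g * lt y ∈ C := by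
    by_contra hcon
    simp only [hCd, mem_tr] at gC hcon
    rw [← mul_assoc] at hcon
    obtain ⟨-, h5⟩ := (E_leave _ _ _).1 ⟨gC, hcon⟩
    have : g0⁻¹ * g = lt l1 * lt l2 := by rw [← h5]; group
    rw [this] at hn
    have := FreeGroup.norm_mul_le (lt l1) (lt l2)
    rw [norm_lt, norm_lt] at this
    omega
  have g0C : g0 ∉ C := by
    rw [hmem]; intro h
    have := h.length_le
    simp at this
  have g0yC : g0 * lt y ∉ C := by
    rw [hmem]; intro h
    have := h.length_le
    simp [toWord_lt] at this
  apply h C B ⟨g0 * lt l1, l2, by rw [im_one]⟩ hB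
  rw [mem_Dl] at h0 h1
  by_cases a : g ∈ B <;> by_cases b : g0 ∈ B
  · exact ⟨⟨g, gC, a⟩, ⟨g * lt y, gyC, by tauto⟩, ⟨g0, g0C, b⟩, ⟨g0 * lt y, g0yC, by tauto⟩⟩
  · exact ⟨⟨g, gC, a⟩, ⟨g * lt y, gyC, by tauto⟩, ⟨g0 * lt y, g0yC, by tauto⟩, ⟨g0, g0C, b⟩⟩
  · exact ⟨⟨g * lt y, gyC, by tauto⟩, ⟨g, gC, a⟩, ⟨g0, g0C, b⟩, ⟨g0 * lt y, g0yC, by tauto⟩⟩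
  · exact ⟨⟨g * lt y, gyC, by tauto⟩, ⟨g, gC, a⟩, ⟨g0 * lt y, g0yC, by tauto⟩, ⟨g0, g0C, b⟩⟩

lemma om0_c {ω : MulAut (FreeGroup α)} (h : ω ∈ Om0 α) {B} (hB : HS ω B) (y : α × Bool) :
    c (lt y) B ≤ {g : FreeGroup α | g.norm ≤ 2}.ncard := by
  unfold c
  rcases (Dl (lt y) B).eq_empty_or_nonempty with he | ⟨g0, h0⟩
  · rw [he]; simp
  · rw [← Set.ncard_image_of_injective (Dl (lt y) B) (mul_right_injective g0⁻¹)]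
    apply Set.ncard_le_ncard _ (ball_finite 2)
    rintro _ ⟨g, hg, rfl⟩
    exact om0_dist h hB y h0 hg

lemma Om0_finite : (Om0 α).Finite := by
  set R := Fintype.card α * {g : FreeGroup α | g.norm ≤ 2}.ncard
  have h1 : ∀ ω ∈ Om0 α, ∀ a, (ω⁻¹ (of a)).norm ≤ R := by
    intro ω hω a
    rw [← Len_eq]
    refine (Finset.sum_le_card_nsmul _ _ {g : FreeGroup α | g.norm ≤ 2}.ncard fun i _ => ?_).trans_eq (by simp [R])
    exact om0_c hω ⟨1, (i, true), by rw [tr_one]⟩ (a, true)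
  have hfin : {f : α → FreeGroup α | ∀ a, f a ∈ {g : FreeGroup α | g.norm ≤ R}}.Finite :=
    Set.Finite.pi' fun _ => ball_finite R
  refine Set.Finite.of_finite_image (f := fun ω : MulAut (FreeGroup α) => fun a => ω⁻¹ (of a)) ?_ ?_
  · refine hfin.subset ?_
    rintro _ ⟨ω, hω, rfl⟩
    exact h1 ω hω
  · intro ω _ ω' _ he
    have : (ω⁻¹ : MulAut (FreeGroup α)).toMonoidHom = (ω'⁻¹ : MulAut (FreeGroup α)).toMonoidHom := by
      ext a
      exact congrFun he a
    have : ω⁻¹ = ω'⁻¹ := by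
      ext g
      exact DFunLike.congr_fun this g
    exact inv_injective this

/-- moves -/
def Om (α : Type*) [DecidableEq α] : Set (MulAut (FreeGroup α)) :=
  Wh α ∪ (fun ω => ω⁻¹) '' Wh α ∪ (fun ω => ω⁻¹) '' Om0 α

lemma Om_finite : (Om α).Finite := (Wh_finite.union (Wh_finite.image _)).union (Om0_finite.image _)

theorem peak_aux (u : FreeGroup α) (M m : ℕ) : ∀ φ ψ : MulAut (FreeGroup α), Ix φ ψ = m →
    (φ⁻¹ u).norm ≤ M → (ψ⁻¹ u).norm ≤ M →
    Relation.ReflTransGen (fun a b : FreeGroup α => b.norm ≤ M ∧ ∃ ω ∈ Om α, b = ω a) (φ⁻¹ u) (ψ⁻¹ u) := by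
  induction m using Nat.strong_induction_on with
  | _ m ih =>
    rintro φ ψ rfl h1 h2
    by_cases hex : ∃ A B, HS φ A ∧ HS ψ B ∧ cross A B
    · rcases step φ ψ u hex with ⟨ω, hω, h3, h4⟩ | ⟨ω, hω, h3, h4⟩
      · refine Relation.ReflTransGen.head ⟨h3.trans h1, ω⁻¹, ?_, ?_⟩ (ih _ h4 _ _ rfl (h3.trans h1) h2)
        · exact Or.inl (Or.inr ⟨ω, hω, rfl⟩)
        · rw [mul_inv_rev]; rfl
      · refine Relation.ReflTransGen.tail (ih _ h4 _ _ rfl h1 (h3.trans h2)) ⟨h2, ω, ?_, ?_⟩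
        · exact Or.inl (Or.inl hω)
        · rw [mul_inv_rev]; simp
    · refine Relation.ReflTransGen.single ⟨h2, (φ⁻¹ * ψ)⁻¹, Or.inr ⟨φ⁻¹ * ψ, ?_, rfl⟩, ?_⟩
      · intro A B hA hB hc
        apply hex
        refine ⟨im φ A, im φ B, ?_, ?_, cross_im.2 hc⟩
        · simpa using hA.im φ
        · simpa using hB.im φ
      · rw [mul_inv_rev]; simp

theorem peak (a b : FreeGroup α) (θ : MulAut (FreeGroup α)) (h : b = θ a) (M : ℕ) (ha : a.norm ≤ M) (hb : b.norm ≤ M) :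
    Relation.ReflTransGen (fun a b : FreeGroup α => b.norm ≤ M ∧ ∃ ω ∈ Om α, b = ω a) a b := by
  have := peak_aux a M _ 1 θ⁻¹ rfl (by simpa using ha) (by simpa [h] using hb)
  simpa [h] using this

end peak
end MP


namespace MP

open FreeGroup hiding map_mul map_inv map_one
set_option linter.unusedSectionVars false

section code
variable {α : Type*} [DecidableEq α] {J : Type*}

/-- code data -/
structure Code (α : Type*) (J : Type*) where
  s : J → List (α × Bool)
  r : J → List (α × Bool)
  y : J → α × Bool

def Code.st (C : Code α J) (p : J × Bool) : List (α × Bool) := if p.2 then C.s p.1 else C.r p.1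
def Code.yt (C : Code α J) (p : J × Bool) : α × Bool := if p.2 then C.y p.1 else bar (C.y p.1)
def Code.κ (C : Code α J) (p : J × Bool) : List (α × Bool) := C.st p ++ [C.yt p]

structure Code.Good (C : Code α J) : Prop where
  red : ∀ p, FreeGroup.IsReduced (C.κ p)
  pre : ∀ p q, C.κ p <+: C.κ q → p = q

def Code.a (C : Code α J) (j : J) : FreeGroup α :=
  FreeGroup.mk (C.s j) * lt (C.y j) * (FreeGroup.mk (C.r j))⁻¹

def Code.hom (C : Code α J) : FreeGroup J →* FreeGroup α := FreeGroup.lift C.a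

lemma Code.yt_bar (C : Code α J) (p : J × Bool) : C.yt (bar p) = bar (C.yt p) := by
  rcases p with ⟨j, b⟩; cases b <;> simp [Code.yt, bar]

lemma Code.hom_lt (C : Code α J) (p : J × Bool) :
    C.hom (lt p) = FreeGroup.mk (C.st p) * lt (C.yt p) * (FreeGroup.mk (C.st (bar p)))⁻¹ := by
  classical
  rcases p with ⟨j, b⟩; cases b
  · rw [lt_false, map_inv]
    simp [Code.hom, Code.a, Code.st, Code.yt, bar, mul_assoc]
    rw [← lt_bar]; rfl
  · rw [lt_true]; simp [Code.hom, Code.a, Code.st, Code.yt, bar]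

lemma Code.mem (C : Code α J) (hC : C.Good) (p : J × Bool) (g : FreeGroup α) :
    C.κ p <+: (C.hom (lt p) * g).toWord ↔ ¬ C.κ (bar p) <+: g.toWord := by
  unfold Code.κ
  rw [← cyl _ _ (hC.red p), ← cyl _ _ (hC.red (bar p)), C.hom_lt, C.yt_bar, ← lt_mul_mem_E]
  have : (FreeGroup.mk (C.st p))⁻¹ * (FreeGroup.mk (C.st p) * lt (C.yt p) * (FreeGroup.mk (C.st (bar p)))⁻¹ * g)
    = lt (C.yt p) * ((FreeGroup.mk (C.st (bar p)))⁻¹ * g) := by group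
  rw [this]

lemma Code.disj (C : Code α J) (hC : C.Good) {p q : J × Bool} {l : List (α × Bool)}
    (h1 : C.κ p <+: l) (h2 : C.κ q <+: l) : p = q := by
  rcases List.prefix_or_prefix_of_prefix h1 h2 with h | h
  · exact hC.pre _ _ h
  · exact (hC.pre _ _ h).symm

lemma Code.main (C : Code α J) (hC : C.Good) (L : List (J × Bool)) : ∀ p, FreeGroup.IsReduced (p :: L) →
    C.κ p <+: (C.hom (FreeGroup.mk (p :: L))).toWord := by
  classical
  induction L with
  | nil =>
    intro p _
    have := (C.mem hC p 1).2 (by simp [Code.κ])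
    rwa [mul_one] at this
  | cons q L ih =>
    intro p hp
    have h2 := red_cons.1 hp
    rw [mk_cons, map_mul, C.mem hC]
    intro hcon
    have := C.disj hC hcon (ih q h2.2)
    exact h2.1 q (by simp) this.symm

theorem Code.inj (C : Code α J) (hC : C.Good) : Function.Injective C.hom := by
  classical
  rw [injective_iff_map_eq_one]
  intro g hg
  by_contra hne
  rcases hw : g.toWord with _ | ⟨p, L⟩
  · exact hne (toWord_eq_nil_iff.1 hw)
  · have := C.main hC L p (hw ▸ isReduced_toWord)
    rw [← hw, mk_toWord, hg] at this
    simp [Code.κ] at this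

lemma isRed_replicate (c : α × Bool) (k : ℕ) : FreeGroup.IsReduced (List.replicate k c) := by
  induction k with
  | zero => simp
  | succ k ih =>
    rw [List.replicate_succ, red_cons]
    refine ⟨?_, ih⟩
    intro y hy
    have : y = c := by
      have := List.mem_of_mem_head? hy
      exact (List.mem_replicate.1 this).2
    rw [this]; exact (bar_ne c).symm

lemma repl_pre {c x y : α × Bool} (hx : x ≠ c) {i j : ℕ}
    (h : List.replicate i c ++ [x] <+: List.replicate j c ++ [y]) : i = j ∧ x = y := by
  have hl := h.length_le
  simp at hl
  have h1 := h.getElem (i := i) (by simp)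
  rcases hl.lt_or_eq with hlt | rfl
  · rw [List.getElem_append_right (by simp), List.getElem_append_left (by simpa using hlt)] at h1
    simp at h1
    exact absurd h1 hx
  · simpa using h1

theorem Code.extend {n : ℕ} (hn : 2 ≤ n) (C : Code (Fin n) (Fin n)) (hC : C.Good) (I : Finset (Fin n)) (K : ℕ)
    (hK : ∀ i ∈ I, (C.s i).length ≤ K ∧ (C.r i).length ≤ K) :
    ∃ C' : Code (Fin n) (Fin n), C'.Good ∧ (∀ i ∈ I, C'.a i = C.a i) ∧
      ∀ i, (C'.s i).length ≤ K + n ∧ (C'.r i).length ≤ K + n := by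
  by_cases hI : I = Finset.univ
  · subst hI
    refine ⟨C, hC, fun _ _ => rfl, fun i => ?_⟩
    have := hK i (Finset.mem_univ i)
    omega
  have hcard : I.card < n := by
    have := Finset.card_lt_univ_of_notMem (s := I) (x := (by
      have : ∃ x, x ∉ I := by
        by_contra! h
        exact hI (Finset.eq_univ_of_forall h)
      exact this.choose)) (by
      have : ∃ x, x ∉ I := by
        by_contra! h
        exact hI (Finset.eq_univ_of_forall h)
      exact this.choose_spec)
    simpa using this
  obtain ⟨c, hc⟩ : ∃ c : Fin n × Bool, c ∉ (I ×ˢ (Finset.univ : Finset Bool)).image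
      (fun p => (C.κ p).head (by simp [Code.κ])) := by
    by_contra! h
    have h1 := Finset.card_le_card (fun c _ => h c : (Finset.univ : Finset (Fin n × Bool)) ⊆ _)
    have h2 := h1.trans Finset.card_image_le
    simp at h2
    omega
  obtain ⟨x, hx⟩ : ∃ x : Fin n × Bool, x.1 ≠ c.1 := by
    by_cases h0 : c.1 = ⟨0, by omega⟩
    · exact ⟨(⟨1, by omega⟩, true), by rw [h0]; simp [Fin.ext_iff]⟩
    · exact ⟨(⟨0, by omega⟩, true), fun h => h0 h.symm⟩
  have hcI : ∀ p : Fin n × Bool, p.1 ∈ I → ∀ l, ¬ (C.κ p = c :: l) := by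
    intro p hp l hl
    apply hc
    rw [Finset.mem_image]
    refine ⟨p, by simp [hp], ?_⟩
    simp [hl]
  let C' : Code (Fin n) (Fin n) :=
    { s := fun i => if i ∈ I then C.s i else List.replicate (i + 1) c
      r := fun i => if i ∈ I then C.r i else List.replicate (i + 1) c
      y := fun i => if i ∈ I then C.y i else x }
  have e1 : ∀ p : Fin n × Bool, p.1 ∈ I → C'.κ p = C.κ p := by
    intro p hp
    simp [Code.κ, Code.st, Code.yt, C', hp]
  let z : Bool → Fin n × Bool := fun b => if b then x else bar x
  have hz1 : ∀ b, (z b).1 ≠ c.1 := by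
    intro b; cases b
    · simpa [z, bar_fst] using hx
    · simpa [z] using hx
  have hzc : ∀ b, z b ≠ c := fun b h => hz1 b (by rw [h])
  have hzi : ∀ b b', z b = z b' → b = b' := by
    intro b b' h
    have h1 := bar_ne x
    have h2 := (bar_ne x).symm
    cases b <;> cases b' <;> simp_all [z]
  have e2 : ∀ p : Fin n × Bool, p.1 ∉ I → C'.κ p = List.replicate (p.1 + 1) c ++ [z p.2] := by
    intro p hp
    simp [Code.κ, Code.st, Code.yt, C', hp, z]
  refine ⟨C', ⟨?_, ?_⟩, ?_, ?_⟩
  · intro p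
    by_cases hp : p.1 ∈ I
    · rw [e1 p hp]; exact hC.red p
    · rw [e2 p hp, red_concat]
      refine ⟨?_, isRed_replicate _ _⟩
      intro y hy
      have : y = c := by
        have := List.mem_of_getLast? hy
        exact (List.mem_replicate.1 this).2
      rw [this]
      intro h
      apply hz1 p.2
      rw [h, bar_fst]
  · intro p q h
    by_cases hp : p.1 ∈ I <;> by_cases hq : q.1 ∈ I
    · rw [e1 p hp, e1 q hq] at h; exact hC.pre _ _ h
    · exfalso
      rw [e1 p hp, e2 q hq] at h
      obtain ⟨t, ht⟩ := h
      rcases hh : C.κ p with _ | ⟨a, l⟩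
      · simp [Code.κ] at hh
      · rw [hh, List.replicate_succ] at ht
        simp only [List.cons_append, List.cons.injEq] at ht
        exact hcI p hp l (by rw [hh, ht.1])
    · exfalso
      rw [e2 p hp, e1 q hq] at h
      obtain ⟨t, ht⟩ := h
      rw [List.replicate_succ] at ht
      exact hcI q hq _ (by rw [← ht]; rfl)
    · rw [e2 p hp, e2 q hq] at h
      obtain ⟨h1, h2⟩ := repl_pre (hzc _) h
      exact Prod.ext (Fin.ext (by omega)) (hzi _ _ h2)
  · intro i hi
    simp [Code.a, C', hi]
  · intro i
    by_cases hi : i ∈ I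
    · have := hK i hi
      simp only [C', hi, if_true]; omega
    · simp only [C', hi, if_false, List.length_replicate]
      omega

end code
end MP


namespace MP

open FreeGroup hiding map_mul map_inv map_one
set_option linter.unusedSectionVars false

section schreier
variable {α : Type*} [DecidableEq α] [Fintype α]

variable (α) in
def Bs : ℕ := Fintype.card (α × Bool) + 1

noncomputable def dg (y : α × Bool) : ℕ := (Fintype.equivFin (α × Bool) y : ℕ) + 1

lemma dg_lt (y : α × Bool) : dg y < Bs α := by unfold dg Bs; omega
lemma dg_pos (y : α × Bool) : 1 ≤ dg y := by unfold dg; omega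
lemma dg_inj {x y : α × Bool} (h : dg x = dg y) : x = y := by
  unfold dg at h
  apply (Fintype.equivFin (α × Bool)).injective
  apply Fin.ext; omega

noncomputable def keyL (l : List (α × Bool)) : ℕ := l.foldl (fun acc y => acc * Bs α + dg y) 0

lemma keyL_nil : keyL ([] : List (α × Bool)) = 0 := rfl
lemma keyL_concat (l : List (α × Bool)) (y) : keyL (l ++ [y]) = keyL l * Bs α + dg y := by
  simp [keyL]

lemma Bs_pos : 1 ≤ Bs α := by unfold Bs; omega

lemma keyL_lt (l : List (α × Bool)) : keyL l < Bs α ^ l.length := by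
  induction l using List.reverseRecOn with
  | nil => simp [keyL_nil]
  | append_singleton l y ih =>
    rw [keyL_concat, List.length_append, List.length_singleton, pow_succ]
    have := dg_lt y
    have h2 : (keyL l + 1) * Bs α ≤ Bs α ^ l.length * Bs α := Nat.mul_le_mul_right _ ih
    rw [add_mul] at h2
    omega

lemma keyL_ge (l : List (α × Bool)) : Bs α ^ l.length ≤ keyL l * Bs α + 1 := by
  induction l using List.reverseRecOn with
  | nil => simp [keyL_nil]
  | append_singleton l y ih =>
    rw [keyL_concat, List.length_append, List.length_singleton, pow_succ]
    have := dg_pos y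
    have h2 := Nat.mul_le_mul_right (Bs α) ih
    have h3 := Nat.mul_le_mul_right (Bs α) this
    have h4 := Bs_pos (α := α)
    rw [add_mul] at h2 ⊢
    omega

lemma keyL_inj (l m : List (α × Bool)) (h : keyL l = keyL m) : l = m := by
  induction l using List.reverseRecOn generalizing m with
  | nil =>
    rcases List.eq_nil_or_concat m with rfl | ⟨m, y, rfl⟩
    · rfl
    · rw [List.concat_eq_append, keyL_concat, keyL_nil] at h
      have := dg_pos y; omega
  | append_singleton l x ih =>
    rcases List.eq_nil_or_concat m with rfl | ⟨m, y, rfl⟩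
    · rw [keyL_concat, keyL_nil] at h
      have := dg_pos x; omega
    · rw [List.concat_eq_append] at h ⊢
      rw [keyL_concat, keyL_concat] at h
      have h1 := dg_lt x
      have h2 := dg_lt y
      have h3 : dg x = dg y := by
        have := congrArg (· % Bs α) h
        simpa [Nat.mul_add_mod', Nat.mod_eq_of_lt h1, Nat.mod_eq_of_lt h2] using this
      have h4 : keyL l = keyL m := by
        rw [h3] at h
        have := Nat.add_right_cancel h
        exact Nat.eq_of_mul_eq_mul_right Bs_pos this
      rw [ih m h4, dg_inj h3]

noncomputable def key (g : FreeGroup α) : ℕ := keyL g.toWord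

lemma key_one : key (1 : FreeGroup α) = 0 := by simp [key, keyL_nil]
lemma key_inj {g h : FreeGroup α} (e : key g = key h) : g = h := toWord_injective (keyL_inj _ _ e)

lemma key_norm {g h : FreeGroup α} (e : key g ≤ key h) : g.norm ≤ h.norm := by
  by_contra hcon
  push Not at hcon
  have h1 := keyL_ge g.toWord
  have h2 := keyL_lt h.toWord
  have h3 : Bs α ^ (h.toWord.length + 1) ≤ Bs α ^ g.toWord.length := Nat.pow_le_pow_right Bs_pos hcon
  rw [pow_succ] at h3
  have h4 : (keyL h.toWord + 1) * Bs α ≤ Bs α ^ h.toWord.length * Bs α := Nat.mul_le_mul_right _ h2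
  have h5 : keyL g.toWord * Bs α ≤ keyL h.toWord * Bs α := Nat.mul_le_mul_right _ e
  rw [add_mul] at h4
  have h6 : 1 < Bs α ∨ g.toWord = [] := by
    rcases hg : g.toWord with _ | ⟨a, l⟩
    · right; rfl
    · left
      have := dg_pos a
      have := dg_lt a
      omega
  rcases h6 with h6 | h6
  · omega
  · unfold FreeGroup.norm at hcon
    rw [h6] at hcon; simp at hcon

lemma key_concat {s : List (α × Bool)} {y} (h : FreeGroup.IsReduced (s ++ [y])) :
    key (FreeGroup.mk (s ++ [y])) = key (FreeGroup.mk s) * Bs α + dg y := by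
  unfold key
  rw [toWord_mk_of_red h, toWord_mk_of_red (reduced_append_left h), keyL_concat]

lemma key_mul_le (g : FreeGroup α) (y : α × Bool) : key (g * lt y) ≤ key g * Bs α + dg y := by
  unfold key
  rcases toWord_mul_lt y g with h | ⟨-, h⟩
  · rw [h, keyL_concat]
    have := Nat.mul_le_mul (Nat.le_add_right (keyL (g * lt y).toWord * Bs α) (dg (bar y))) (Bs_pos (α := α))
    have h2 := Nat.le_mul_of_pos_right (keyL (g * lt y).toWord) (Bs_pos (α := α))
    have h3 := Nat.mul_le_mul_left (keyL (g * lt y).toWord * Bs α + dg (bar y)) (Bs_pos (α := α))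
    omega
  · rw [h, keyL_concat]

variable (H : Subgroup (FreeGroup α))

lemma rep_exists (g : FreeGroup α) : ∃ k, k * g⁻¹ ∈ H ∧ ∀ k', k' * g⁻¹ ∈ H → key k ≤ key k' := by
  classical
  have hex : ∃ m, ∃ k, k * g⁻¹ ∈ H ∧ key k = m := ⟨_, g, by simp, rfl⟩
  obtain ⟨k, h1, h2⟩ := Nat.find_spec hex
  refine ⟨k, h1, fun k' hk' => ?_⟩
  rw [h2]
  exact Nat.find_min' hex ⟨k', hk', rfl⟩

noncomputable def rep (g : FreeGroup α) : FreeGroup α := (rep_exists H g).choose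

lemma rep_mem (g) : rep H g * g⁻¹ ∈ H := (rep_exists H g).choose_spec.1
lemma rep_le {g k} (h : k * g⁻¹ ∈ H) : key (rep H g) ≤ key k := (rep_exists H g).choose_spec.2 k h

lemma rep_congr {g k} (h : k * g⁻¹ ∈ H) : rep H g = rep H k := by
  have a := rep_mem H g
  have b := rep_mem H k
  apply key_inj
  apply le_antisymm
  · apply rep_le
    have := H.mul_mem b h
    simpa [mul_assoc] using this
  · apply rep_le
    have := H.mul_mem a (H.inv_mem h)
    simpa [mul_assoc] using this

lemma rep_rep (g) : rep H (rep H g) = rep H g := (rep_congr H (rep_mem H g)).symm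

lemma rep_rep_mul (g k) : rep H (rep H g * k) = rep H (g * k) := by
  apply (rep_congr H _).symm
  have := rep_mem H g
  simpa [mul_assoc] using this

lemma rep_of_mem {g} (h : g ∈ H) : rep H g = 1 := by
  apply key_inj
  rw [key_one]
  have := rep_le H (g := g) (k := 1) (by simpa using h)
  rw [key_one] at this
  omega

lemma rep_norm (g) : (rep H g).norm ≤ g.norm := key_norm (rep_le H (by simp))

lemma T_concat {s : List (α × Bool)} {y} (h : FreeGroup.IsReduced (s ++ [y]))
    (hT : rep H (FreeGroup.mk (s ++ [y])) = FreeGroup.mk (s ++ [y])) :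
    rep H (FreeGroup.mk s) = FreeGroup.mk s := by
  apply key_inj
  apply le_antisymm (rep_le H (by rw [mul_inv_cancel]; exact H.one_mem))
  by_contra hcon
  push Not at hcon
  have h1 : key (rep H (FreeGroup.mk (s ++ [y]))) ≤ key (rep H (FreeGroup.mk s) * lt y) := by
    apply rep_le
    rw [mk_concat]
    have := rep_mem H (FreeGroup.mk s)
    simpa [mul_assoc] using this
  rw [hT, key_concat h] at h1
  have h2 := key_mul_le (rep H (FreeGroup.mk s)) y
  have h3 := Nat.mul_lt_mul_of_pos_right hcon (Bs_pos (α := α))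
  omega

lemma T_prefix {l s : List (α × Bool)} (h : s <+: l) (hl : FreeGroup.IsReduced l)
    (hT : rep H (FreeGroup.mk l) = FreeGroup.mk l) : rep H (FreeGroup.mk s) = FreeGroup.mk s := by
  obtain ⟨t, rfl⟩ := h
  induction t using List.reverseRecOn with
  | nil => simpa using hT
  | append_singleton t y ih =>
    rw [← List.append_assoc] at hl hT
    exact ih (reduced_append_left hl) (T_concat H hl hT)

lemma edge_red {t : FreeGroup α} {y} (ht : rep H t = t) (hy : rep H (t * lt y) ≠ t * lt y) :
    FreeGroup.IsReduced (t.toWord ++ [y]) := by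
  rw [red_concat]
  refine ⟨?_, isReduced_toWord⟩
  intro z hz hzy
  subst hzy
  apply hy
  rcases toWord_mul_lt y t with h | ⟨h, -⟩
  · have := T_prefix H (l := t.toWord) (s := (t * lt y).toWord) ⟨[bar y], h.symm⟩ isReduced_toWord
      (by rwa [mk_toWord])
    rwa [mk_toWord] at this
  · exact absurd hz h

/-- Schreier generators -/
def SJ : Type _ := {q : FreeGroup α × α // rep H q.1 = q.1 ∧ rep H (q.1 * of q.2) ≠ q.1 * of q.2}

noncomputable def SC : Code α (SJ H) where
  s j := j.1.1.toWord
  r j := (rep H (j.1.1 * of j.1.2)).toWord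
  y j := (j.1.2, true)

noncomputable def tt (p : SJ H × Bool) : FreeGroup α := if p.2 then p.1.1.1 else rep H (p.1.1.1 * of p.1.1.2)
def yy (p : SJ H × Bool) : α × Bool := (p.1.1.2, p.2)

lemma SC_κ (p : SJ H × Bool) : (SC H).κ p = (tt H p).toWord ++ [yy H p] := by
  rcases p with ⟨j, b⟩
  cases b <;> simp [Code.κ, Code.st, Code.yt, SC, tt, yy, bar]

lemma tt_back (j : SJ H) : rep H (rep H (j.1.1 * of j.1.2) * lt (j.1.2, false)) = j.1.1 := by
  rw [rep_rep_mul, lt_false, mul_inv_cancel_right, j.2.1]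

lemma tt_T (p : SJ H × Bool) : rep H (tt H p) = tt H p := by
  rcases p with ⟨j, b⟩
  cases b
  · simp [tt, rep_rep]
  · simpa [tt] using j.2.1

lemma tt_nT (p : SJ H × Bool) : rep H (tt H p * lt (yy H p)) ≠ tt H p * lt (yy H p) := by
  rcases p with ⟨j, b⟩
  cases b
  · simp only [tt, yy, Bool.false_eq_true, if_false]
    rw [tt_back]
    intro h
    apply j.2.2
    rw [lt_false] at h
    rw [eq_mul_inv_iff_mul_eq] at h
    exact h.symm
  · simpa [tt, yy, lt_true] using j.2.2

lemma ty_inj {p q : SJ H × Bool} (h1 : tt H p = tt H q) (h2 : yy H p = yy H q) : p = q := by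
  rcases p with ⟨j, b⟩
  rcases q with ⟨k, d⟩
  simp only [yy, Prod.mk.injEq] at h2
  obtain ⟨h2, rfl⟩ := h2
  refine Prod.ext (Subtype.ext (Prod.ext ?_ h2)) rfl
  cases b
  · have h3 := tt_back H j
    have h4 := tt_back H k
    simp only [tt, Bool.false_eq_true, if_false] at h1
    rw [h1, h2, h4] at h3
    exact h3.symm
  · simpa [tt] using h1

lemma SC_good : (SC H).Good := by
  constructor
  · intro p
    rw [SC_κ]
    exact edge_red H (tt_T H p) (tt_nT H p)
  · intro p q h
    rw [SC_κ, SC_κ, List.prefix_concat_iff] at h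
    rcases h with h | h
    · have := List.append_inj' h rfl
      exact ty_inj H (toWord_injective this.1) (by simpa using this.2)
    · exfalso
      have := T_prefix H h isReduced_toWord (by rw [mk_toWord]; exact tt_T H q)
      rw [mk_concat, mk_toWord] at this
      exact tt_nT H p this

lemma SC_a_mem (j : SJ H) : (SC H).a j ∈ H := by
  simp only [Code.a, SC, mk_toWord, lt_true]
  have := H.inv_mem (rep_mem H (j.1.1 * of j.1.2))
  simpa [mul_assoc] using this

theorem SC_rewrite (L : List (α × Bool)) : ∃ W : List (SJ H × Bool),
    FreeGroup.mk L * (rep H (FreeGroup.mk L))⁻¹ = (SC H).hom (FreeGroup.mk W) ∧ W.length ≤ L.length ∧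
    ∀ p ∈ W, ((SC H).s p.1).length ≤ L.length ∧ ((SC H).r p.1).length ≤ L.length := by
  classical
  induction L using List.reverseRecOn with
  | nil => exact ⟨[], by rw [← FreeGroup.one_eq_mk, ← FreeGroup.one_eq_mk, map_one, rep_of_mem H H.one_mem]; simp, le_rfl, by simp⟩
  | append_singleton L y ih =>
    obtain ⟨W, h1, h2, h3⟩ := ih
    set t := rep H (FreeGroup.mk L) with ht
    have htT : rep H t = t := rep_rep H _
    have e : rep H (FreeGroup.mk (L ++ [y])) = rep H (t * lt y) := by
      rw [mk_concat, ht, rep_rep_mul]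
    have e2 : FreeGroup.mk (L ++ [y]) * (rep H (FreeGroup.mk (L ++ [y])))⁻¹ =
        (SC H).hom (FreeGroup.mk W) * (t * lt y * (rep H (t * lt y))⁻¹) := by
      rw [e, ← h1, mk_concat]; group
    have n1 : t.norm ≤ L.length := (rep_norm H _).trans FreeGroup.norm_mk_le
    have n2 : (rep H (t * lt y)).norm ≤ L.length + 1 := by
      rw [← e]
      have := (rep_norm H (FreeGroup.mk (L ++ [y]))).trans FreeGroup.norm_mk_le
      simpa using this
    by_cases hT : rep H (t * lt y) = t * lt y
    · refine ⟨W, ?_, ?_, ?_⟩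
      · rw [e2, hT]; simp
      · simp; omega
      · intro p hp
        have := h3 p hp
        simp; omega
    · have : ∃ p : SJ H × Bool, (SC H).hom (lt p) = t * lt y * (rep H (t * lt y))⁻¹ ∧
          ((SC H).s p.1).length ≤ L.length + 1 ∧ ((SC H).r p.1).length ≤ L.length + 1 := by
        rcases y with ⟨i, b⟩
        cases b
        · set t1 := rep H (t * lt (i, false)) with ht1
          have hb : rep H (t1 * of i) = t := by
            rw [ht1, rep_rep_mul, lt_false, inv_mul_cancel_right, htT]
          refine ⟨(⟨(t1, i), rep_rep H _, ?_⟩, false), ?_, ?_, ?_⟩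
          · change rep H (t1 * of i) ≠ t1 * of i
            rw [hb]
            intro h
            apply hT
            rw [h, lt_false, mul_inv_cancel_right]
          · rw [Code.hom_lt]
            simp only [Code.st, Code.yt, SC, bar, Bool.false_eq_true, if_false, Bool.not_false, if_true, mk_toWord, hb,
              Bool.not_true]
          · exact n2
          · change (rep H (t1 * of i)).norm ≤ _
            rw [hb]; omega
        · refine ⟨(⟨(t, i), htT, hT⟩, true), ?_, ?_, ?_⟩
          · rw [Code.hom_lt]
            simp only [Code.st, Code.yt, SC, bar, Bool.false_eq_true, if_false, if_true, mk_toWord,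
              Bool.not_true, lt_true]
          · change t.norm ≤ _
            omega
          · exact n2
      obtain ⟨p, hp, hp1, hp2⟩ := this
      refine ⟨W ++ [p], ?_, ?_, ?_⟩
      · rw [e2, mk_concat, map_mul, hp]
      · simp; omega
      · intro q hq
        rw [List.mem_append, List.mem_singleton] at hq
        rcases hq with hq | rfl
        · have := h3 q hq
          simp; omega
        · simpa using ⟨hp1, hp2⟩

end schreier
end MP


namespace MP

open FreeGroup hiding map_mul map_inv map_one
set_option linter.unusedSectionVars false

section forward

def Code.tr {α J J' : Type*} (C : Code α J) (e : J' → J) : Code α J' :=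
  ⟨fun j => C.s (e j), fun j => C.r (e j), fun j => C.y (e j)⟩

lemma Code.tr_κ {α J J' : Type*} (C : Code α J) (e : J' → J) (p : J' × Bool) :
    (C.tr e).κ p = C.κ (e p.1, p.2) := rfl

lemma Code.tr_good {α J J' : Type*} [DecidableEq α] (C : Code α J) (hC : C.Good) (e : J' → J)
    (he : Function.Injective e) : (C.tr e).Good := by
  refine ⟨fun p => ?_, fun p q h => ?_⟩
  · rw [Code.tr_κ]; exact hC.red _
  · rw [Code.tr_κ, Code.tr_κ] at h
    have := hC.pre _ _ h
    rw [Prod.mk.injEq] at this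
    exact Prod.ext (he this.1) this.2

lemma Code.hom_congr {α J J' : Type*} [DecidableEq α] [DecidableEq J] [DecidableEq J'] (C : Code α J) (C' : Code α J') (e : J → J')
    (W : List (J × Bool)) (h : ∀ p ∈ W, C'.a (e p.1) = C.a p.1) :
    C'.hom (FreeGroup.mk (W.map (fun p => (e p.1, p.2)))) = C.hom (FreeGroup.mk W) := by
  induction W with
  | nil => rw [List.map_nil, ← FreeGroup.one_eq_mk, ← FreeGroup.one_eq_mk, map_one, map_one]
  | cons p W ih =>
    rw [List.map_cons, mk_cons, mk_cons, map_mul, map_mul, ih (fun q hq => h q (by simp [hq]))]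
    congr 1
    have := h p (by simp)
    rcases p with ⟨j, b⟩
    cases b
    · rw [lt_false, lt_false]; simp only [map_inv, Code.hom, FreeGroup.lift_apply_of]; exact congrArg _ this
    · rw [lt_true, lt_true]; simp only [Code.hom, FreeGroup.lift_apply_of]; exact this

theorem forward {n : ℕ} (hn : 2 ≤ n) (U V : List (Fin n × Bool)) (f : FreeGroup (Fin n) →* FreeGroup (Fin n))
    (hf : Function.Injective f) (hUV : f (FreeGroup.mk U) = FreeGroup.mk V) :
    ∃ (θ : MulAut (FreeGroup (Fin n))) (W : List (Fin n × Bool)), W.length ≤ V.length ∧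
      θ (FreeGroup.mk U) = FreeGroup.mk W ∧
      ∃ C : Code (Fin n) (Fin n), C.Good ∧
        (∀ i, (C.s i).length ≤ V.length + n ∧ (C.r i).length ≤ V.length + n) ∧
        C.hom (FreeGroup.mk W) = FreeGroup.mk V := by
  classical
  have hr : (SC f.range).hom.range = f.range := by
    apply le_antisymm
    · rintro _ ⟨x, rfl⟩
      induction x using FreeGroup.induction_on with
      | C1 => rw [map_one]; exact one_mem _
      | of j => simpa [Code.hom] using SC_a_mem f.range j
      | inv_of j h => rw [map_inv]; exact inv_mem h
      | mul x y hx hy => rw [map_mul]; exact mul_mem hx hy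
    · intro g hg
      obtain ⟨W, h1, -⟩ := SC_rewrite f.range g.toWord
      rw [mk_toWord, rep_of_mem _ hg] at h1
      exact ⟨_, by rw [← h1]; simp⟩
  have hVm : FreeGroup.mk V ∈ f.range := ⟨_, hUV⟩
  obtain ⟨W, h1, h2, h3⟩ := SC_rewrite f.range V
  rw [rep_of_mem _ hVm, inv_one, mul_one] at h1
  set S := SC f.range with hS
  have hSi : Function.Injective S.hom := S.inj (SC_good _)
  let E : FreeGroup (SJ f.range) ≃* FreeGroup (Fin n) :=
    ((MonoidHom.ofInjective hSi).trans (MulEquiv.subgroupCongr hr)).trans (MonoidHom.ofInjective hf).symm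
  have hE : ∀ x, f (E x) = S.hom x := by
    intro x
    have : (MonoidHom.ofInjective hf) (E x) = (MulEquiv.subgroupCongr hr) (MonoidHom.ofInjective hSi x) := by
      simp [E]
    have := congrArg Subtype.val this
    exact this
  have hEW : E (FreeGroup.mk W) = FreeGroup.mk U := hf (by rw [hE, ← h1, hUV])
  let e : SJ f.range ≃ Fin n := Equiv.ofFreeGroupEquiv E
  let W' := W.map (fun p => (e p.1, p.2))
  obtain ⟨C, hC, hCa, hCl⟩ := Code.extend hn (S.tr e.symm) (S.tr_good (SC_good _) _ e.symm.injective)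
    (W'.map Prod.fst).toFinset V.length (by
      intro i hi
      simp only [W', List.mem_toFinset, List.mem_map] at hi
      obtain ⟨_, ⟨p, hp, rfl⟩, rfl⟩ := hi
      simpa [Code.tr] using h3 p hp)
  refine ⟨E.symm.trans (FreeGroup.freeGroupCongr e), W', by simpa [W'] using h2, ?_, C, hC, hCl, ?_⟩
  · rw [MulEquiv.trans_apply, ← hEW, MulEquiv.symm_apply_apply]
    rfl
  · rw [h1]
    refine Code.hom_congr S C e W ?_
    intro p hp
    rw [hCa]
    · simp [Code.tr, Code.a]
    · simp only [W', List.mem_toFinset, List.mem_map]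
      exact ⟨_, ⟨p, hp, rfl⟩, rfl⟩

end forward
end MP


namespace MP

open FreeGroup hiding map_mul map_inv map_one
set_option linter.unusedSectionVars false

section path

lemma rtg_avoid {X : Type*} {R : X → X → Prop} {c b : X} (h : Relation.ReflTransGen R c b) :
    Relation.ReflTransGen (fun x y => R x y ∧ y ≠ c) c b := by
  induction h with
  | refl => exact .refl
  | @tail x y _ h2 ih =>
    by_cases hc : y = c
    · subst hc; exact .refl
    · exact ih.tail ⟨h2, hc⟩

lemma short {X ι : Type*} [DecidableEq X] (T : ι → X → X) (k : ℕ) : ∀ (S : Finset X) (_ : S.card ≤ k) (a b : X),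
    Relation.ReflTransGen (fun x y => y ∈ S ∧ ∃ i, y = T i x) a b →
    ∃ l : List ι, l.length ≤ k ∧ b = l.foldl (fun x i => T i x) a := by
  induction k with
  | zero =>
    intro S hS a b h
    have : S = ∅ := Finset.card_eq_zero.1 (by omega)
    subst this
    rcases Relation.ReflTransGen.cases_head h with h | ⟨c, h, _⟩
    · exact ⟨[], by simp, h.symm⟩
    · simp at h
  | succ k ih =>
    intro S hS a b h
    rcases Relation.ReflTransGen.cases_head h with h | ⟨c, ⟨hc, i, hi⟩, h⟩
    · exact ⟨[], by simp, h.symm⟩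
    · have h2 := rtg_avoid h
      have h3 : Relation.ReflTransGen (fun x y => y ∈ S.erase c ∧ ∃ i, y = T i x) c b := by
        refine Relation.ReflTransGen.mono ?_ _ _ h2
        rintro x y ⟨⟨h1, h2⟩, h3⟩
        exact ⟨Finset.mem_erase.2 ⟨h3, h1⟩, h2⟩
      obtain ⟨l, hl, hb⟩ := ih (S.erase c) (by rw [Finset.card_erase_of_mem hc]; omega) c b h3
      exact ⟨i :: l, by simpa using hl, by rw [List.foldl_cons, ← hi, hb]⟩

def allL {β : Type*} (A : List β) (k : ℕ) : List (List β) :=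
  k.rec [[]] (fun _ IH => [] :: A.flatMap (fun a => IH.map (fun l => a :: l)))

lemma mem_allL {β : Type*} (A : List β) (k : ℕ) : ∀ l, l ∈ allL A k ↔ l.length ≤ k ∧ ∀ x ∈ l, x ∈ A := by
  induction k with
  | zero =>
    intro l
    change l ∈ [[]] ↔ _
    rw [List.mem_singleton]
    constructor
    · rintro rfl; simp
    · intro h; exact List.length_eq_zero_iff.1 (by omega)
  | succ k ih =>
    intro l
    change l ∈ [] :: A.flatMap (fun a => (allL A k).map (fun l => a :: l)) ↔ _
    rw [List.mem_cons, List.mem_flatMap]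
    simp only [List.mem_map]
    cases l with
    | nil => simp
    | cons x l =>
      have := ih l
      constructor
      · rintro (h | ⟨a, ha, l', hl', h⟩)
        · simp at h
        · simp only [List.cons.injEq] at h
          obtain ⟨rfl, rfl⟩ := h
          rw [this] at hl'
          simp only [List.length_cons, List.mem_cons]
          refine ⟨by omega, ?_⟩
          rintro y (rfl | hy)
          · exact ha
          · exact hl'.2 y hy
      · rintro ⟨h1, h2⟩
        refine Or.inr ⟨x, h2 x (by simp), l, ?_, rfl⟩
        rw [this]
        exact ⟨by simpa using h1, fun y hy => h2 y (by simp [hy])⟩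

lemma allL_prim {β : Type*} [Primcodable β] : Primrec₂ (allL : List β → ℕ → List (List β)) := by
  have : Primrec fun p : List β × ℕ => p.2.rec (motive := fun _ => List (List β)) [[]]
      (fun _ IH => [] :: p.1.flatMap (fun a => IH.map (fun l => a :: l))) := by
    refine Primrec.nat_rec' (f := fun p : List β × ℕ => p.2) (g := fun _ => [[]])
      (h := fun p q => [] :: p.1.flatMap (fun a => q.2.map (fun l => a :: l))) Primrec.snd (Primrec.const _) ?_
    refine Primrec₂.comp Primrec.list_cons (Primrec.const _) ?_
    refine Primrec.list_flatMap (f := fun x : (List β × ℕ) × ℕ × List (List β) => x.1.1)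
      (g := fun x a => x.2.2.map (fun l => a :: l)) (Primrec.fst.comp Primrec.fst) ?_
    refine Primrec.list_map (f := fun x : ((List β × ℕ) × ℕ × List (List β)) × β => x.1.2.2)
      (g := fun x l => x.2 :: l) (Primrec.snd.comp (Primrec.snd.comp Primrec.fst)) ?_
    exact Primrec.list_cons.comp (Primrec.snd.comp Primrec.fst) Primrec.snd
  exact this

end path

section moves
variable {α : Type*} [DecidableEq α] [Fintype α]

lemma exists_moves (α : Type*) [DecidableEq α] [Fintype α] : ∃ (m : ℕ) (T : Fin m → MulAut (FreeGroup α)), ∀ ω ∈ Om α, ∃ k, T k = ω := by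
  have hfin : Finite (Om α) := (Om_finite (α := α))
  obtain ⟨m, ⟨e⟩⟩ := Finite.exists_equiv_fin (Om α)
  exact ⟨m, fun k => (e.symm k).1, fun ω hω => ⟨e ⟨ω, hω⟩, by simp⟩⟩

/-- apply a table of words to a word -/
def stp {m : ℕ} (tab : Fin m × (α × Bool) → List (α × Bool)) (W : List (α × Bool)) (k : Fin m) : List (α × Bool) :=
  W.flatMap (fun p => tab (k, p))

lemma mk_append' (A B : List (α × Bool)) : FreeGroup.mk (A ++ B) = FreeGroup.mk A * FreeGroup.mk B :=
  FreeGroup.mul_mk.symm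

lemma mk_flatMap {J : Type*} (g : FreeGroup J →* FreeGroup α) (t : J × Bool → List (α × Bool))
    (ht : ∀ p, FreeGroup.mk (t p) = g (lt p)) (W : List (J × Bool)) :
    FreeGroup.mk (W.flatMap t) = g (FreeGroup.mk W) := by
  classical
  induction W with
  | nil => rw [List.flatMap_nil, ← FreeGroup.one_eq_mk, ← FreeGroup.one_eq_mk, map_one]
  | cons p W ih => rw [List.flatMap_cons, mk_append', ih, ht, mk_cons, map_mul]

lemma mk_foldl {m : ℕ} (T : Fin m → MulAut (FreeGroup α)) (ms : List (Fin m)) : ∀ (W : List (α × Bool)),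
    FreeGroup.mk (ms.foldl (stp (fun q => (T q.1 (lt q.2)).toWord)) W) = ms.foldl (fun x k => T k x) (FreeGroup.mk W) := by
  induction ms with
  | nil => intro W; rfl
  | cons k ms ih =>
    intro W
    rw [List.foldl_cons, List.foldl_cons, ih]
    congr 1
    exact mk_flatMap (T k).toMonoidHom _ (fun p => by rw [mk_toWord]; rfl) W

lemma foldl_aut {m : ℕ} (T : Fin m → MulAut (FreeGroup α)) (ms : List (Fin m)) : ∃ θ : MulAut (FreeGroup α),
    ∀ x, ms.foldl (fun x k => T k x) x = θ x := by
  induction ms with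
  | nil => exact ⟨1, fun x => rfl⟩
  | cons k ms ih =>
    obtain ⟨θ, h⟩ := ih
    exact ⟨θ * T k, fun x => by rw [List.foldl_cons, h]; rfl⟩

lemma exists_ms {m : ℕ} (T : Fin m → MulAut (FreeGroup α)) (hT : ∀ ω ∈ Om α, ∃ k, T k = ω)
    (A : List (α × Bool)) (hA : ∀ x, x ∈ A) (U W : List (α × Bool)) (θ : MulAut (FreeGroup α))
    (h : θ (FreeGroup.mk U) = FreeGroup.mk W) (M : ℕ) (hU : U.length ≤ M) (hW : W.length ≤ M) :
    ∃ ms : List (Fin m), ms.length ≤ (allL A M).length ∧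
      FreeGroup.mk W = ms.foldl (fun x k => T k x) (FreeGroup.mk U) := by
  have h1 := peak (FreeGroup.mk U) (FreeGroup.mk W) θ h.symm M (FreeGroup.norm_mk_le.trans hU)
    (FreeGroup.norm_mk_le.trans hW)
  refine short (fun k x => T k x) _ ((allL A M).map FreeGroup.mk).toFinset ?_ _ _ (Relation.ReflTransGen.mono ?_ _ _ h1)
  · exact (List.toFinset_card_le _).trans (by simp)
  · rintro x y ⟨h1, ω, hω, h2⟩
    obtain ⟨k, rfl⟩ := hT ω hω
    refine ⟨?_, k, h2⟩
    rw [List.mem_toFinset, List.mem_map]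
    exact ⟨y.toWord, (mem_allL _ _ _).2 ⟨h1, fun x _ => hA x⟩, mk_toWord⟩

end moves
end MP


namespace MP

open FreeGroup hiding map_mul map_inv map_one
set_option linter.unusedSectionVars false

section prim

lemma exL {α β : Type*} [Primcodable α] [Primcodable β] {R : α → β → Prop} (hR : PrimrecRel R) {g : α → List β}
    (hg : Primrec g) : PrimrecPred fun a => ∃ b ∈ g a, R a b := by
  have h1 : PrimrecRel (fun (b : β) (a : α) => R a b) := hR.comp₂ Primrec₂.right Primrec₂.left
  exact h1.exists_mem_list.comp hg Primrec.id

lemma allP {α β : Type*} [Primcodable α] [Primcodable β] {R : α → β → Prop} (hR : PrimrecRel R) {g : α → List β}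
    (hg : Primrec g) : PrimrecPred fun a => ∀ b ∈ g a, R a b := by
  have h1 : PrimrecRel (fun (b : β) (a : α) => R a b) := hR.comp₂ Primrec₂.right Primrec₂.left
  exact h1.forall_mem_list.comp hg Primrec.id

variable {n : ℕ}

abbrev Lt (n : ℕ) := Fin n × Bool
abbrev Wd (n : ℕ) := List (Fin n × Bool)

def rstep (x : Lt n) (r : Wd n) : Wd n :=
  List.casesOn r [x] fun hd tl => if x.1 = hd.1 ∧ x.2 = not hd.2 then tl else x :: hd :: tl

lemma reduce_eq_foldr (l : Wd n) : FreeGroup.reduce l = l.foldr rstep [] := by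
  induction l with
  | nil => rfl
  | cons x l ih => rw [FreeGroup.reduce.cons, ih]; rfl

lemma rstep_prim : Primrec₂ (rstep (n := n)) := by
  refine Primrec.list_casesOn (f := fun x : Lt n × Wd n => x.2) (g := fun x => [x.1])
    (h := fun x q => if x.1.1 = q.1.1 ∧ x.1.2 = not q.1.2 then q.2 else x.1 :: q.1 :: q.2) Primrec.snd ?_ ?_
  · exact Primrec.list_cons.comp Primrec.fst (Primrec.const [])
  · have hq : Primrec fun z : (Lt n × Wd n) × (Lt n × Wd n) => z.2.1 := Primrec.fst.comp Primrec.snd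
    have hx : Primrec fun z : (Lt n × Wd n) × (Lt n × Wd n) => z.1.1 := Primrec.fst.comp Primrec.fst
    have ht : Primrec fun z : (Lt n × Wd n) × (Lt n × Wd n) => z.2.2 := Primrec.snd.comp Primrec.snd
    refine Primrec.ite (PrimrecPred.and ?_ ?_) ht (Primrec.list_cons.comp hx (Primrec.list_cons.comp hq ht))
    · exact Primrec.eq.comp (Primrec.fst.comp hx) (Primrec.fst.comp hq)
    · exact Primrec.eq.comp (Primrec.snd.comp hx) (Primrec.not.comp (Primrec.snd.comp hq))

lemma reduce_prim : Primrec (FreeGroup.reduce : Wd n → Wd n) := by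
  have : Primrec fun l : Wd n => l.foldr (fun b s => rstep b s) [] :=
    Primrec.list_foldr (f := fun l : Wd n => l) (g := fun _ => []) (h := fun _ q => rstep q.1 q.2)
      Primrec.id (Primrec.const _) (rstep_prim.comp (Primrec.fst.comp Primrec.snd) (Primrec.snd.comp Primrec.snd))
  exact this.of_eq fun l => (reduce_eq_foldr l).symm

/-- raw code data -/
abbrev CD (n : ℕ) := List (Wd n) × Wd n

def cOf (y0 : Lt n) (q : CD n) : Code (Fin n) (Fin n) :=
  ⟨fun i => q.1.getD i.val [], fun i => q.1.getD (n + i.val) [], fun i => q.2.getD i.val y0⟩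

lemma st_prim (y0 : Lt n) : Primrec₂ (fun (q : CD n) (p : Lt n) => (cOf y0 q).st p) := by
  have hD : Primrec fun z : CD n × Lt n => z.1.1 := Primrec.fst.comp Primrec.fst
  have hi : Primrec fun z : CD n × Lt n => z.2.1.val := Primrec.fin_val.comp (Primrec.fst.comp Primrec.snd)
  have hb : Primrec fun z : CD n × Lt n => z.2.2 := Primrec.snd.comp Primrec.snd
  exact Primrec.ite (Primrec.eq.comp hb (Primrec.const true)) ((Primrec.list_getD []).comp hD hi)
    ((Primrec.list_getD []).comp hD (Primrec.nat_add.comp (Primrec.const n) hi))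

lemma yt_prim (y0 : Lt n) : Primrec₂ (fun (q : CD n) (p : Lt n) => (cOf y0 q).yt p) := by
  have hD : Primrec fun z : CD n × Lt n => z.1.2 := Primrec.snd.comp Primrec.fst
  have hi : Primrec fun z : CD n × Lt n => z.2.1.val := Primrec.fin_val.comp (Primrec.fst.comp Primrec.snd)
  have hb : Primrec fun z : CD n × Lt n => z.2.2 := Primrec.snd.comp Primrec.snd
  have hy : Primrec fun z : CD n × Lt n => z.1.2.getD z.2.1.val y0 := (Primrec.list_getD y0).comp hD hi
  exact Primrec.ite (Primrec.eq.comp hb (Primrec.const true)) hy ((Primrec.dom_finite bar).comp hy)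

lemma κ_prim (y0 : Lt n) : Primrec₂ (fun (q : CD n) (p : Lt n) => (cOf y0 q).κ p) :=
  Primrec.list_append.comp (st_prim y0) (Primrec.list_cons.comp (yt_prim y0) (Primrec.const []))

def cw (y0 : Lt n) (q : CD n) (p : Lt n) : Wd n :=
  (cOf y0 q).κ p ++ (((cOf y0 q).st (bar p)).map bar).reverse

lemma cw_prim (y0 : Lt n) : Primrec₂ (cw y0) := by
  refine Primrec.list_append.comp (κ_prim y0) (Primrec.list_reverse.comp ?_)
  refine Primrec.list_map (f := fun z : CD n × Lt n => (cOf y0 z.1).st (bar z.2)) (g := fun _ x => bar x) ?_ ?_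
  · exact (st_prim y0).comp Primrec.fst ((Primrec.dom_finite bar).comp Primrec.snd)
  · exact (Primrec.dom_finite bar).comp Primrec.snd

lemma mk_inv_bar (l : Wd n) : FreeGroup.mk (l.map bar).reverse = (FreeGroup.mk l)⁻¹ := by
  rw [FreeGroup.inv_mk]; rfl

lemma mk_cw (y0 : Lt n) (q : CD n) (p : Lt n) : FreeGroup.mk (cw y0 q p) = (cOf y0 q).hom (lt p) := by
  rw [Code.hom_lt, cw, mk_append', mk_inv_bar, Code.κ, mk_concat]

def gd (y0 : Lt n) (A : List (Lt n)) (q : CD n) : Prop :=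
  (∀ p ∈ A, FreeGroup.reduce ((cOf y0 q).κ p) = (cOf y0 q).κ p) ∧
  ∀ p ∈ A, ∀ p' ∈ A, ¬ ((cOf y0 q).κ p = List.take ((cOf y0 q).κ p).length ((cOf y0 q).κ p')) ∨ p = p'

lemma gd_iff (y0 : Lt n) (A : List (Lt n)) (hA : ∀ x, x ∈ A) (q : CD n) : gd y0 A q ↔ (cOf y0 q).Good := by
  constructor
  · rintro ⟨h1, h2⟩
    refine ⟨fun p => FreeGroup.isReduced_iff_reduce_eq.2 (h1 p (hA p)), fun p p' h => ?_⟩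
    rcases h2 p (hA p) p' (hA p') with h' | h'
    · exact absurd (List.prefix_iff_eq_take.1 h) h'
    · exact h'
  · rintro ⟨h1, h2⟩
    refine ⟨fun p _ => FreeGroup.isReduced_iff_reduce_eq.1 (h1 p), fun p _ p' _ => ?_⟩
    rw [or_iff_not_imp_left, not_not]
    intro h
    exact h2 p p' (List.prefix_iff_eq_take.2 h)

lemma gd_prim (y0 : Lt n) (A : List (Lt n)) : PrimrecPred (gd y0 A) := by
  refine PrimrecPred.and ?_ ?_
  · refine allP (R := fun q p => FreeGroup.reduce ((cOf y0 q).κ p) = (cOf y0 q).κ p) ?_ (Primrec.const A)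
    exact Primrec.eq.comp (reduce_prim.comp (κ_prim y0)) (κ_prim y0)
  · refine allP (R := fun q p => ∀ p' ∈ A, ¬ ((cOf y0 q).κ p = List.take ((cOf y0 q).κ p).length ((cOf y0 q).κ p')) ∨ p = p') ?_ (Primrec.const A)
    refine allP (α := CD n × Lt n) (R := fun z p' => ¬ ((cOf y0 z.1).κ z.2 = List.take ((cOf y0 z.1).κ z.2).length ((cOf y0 z.1).κ p')) ∨ z.2 = p') ?_ (Primrec.const A)
    have h1 : Primrec fun w : (CD n × Lt n) × Lt n => (cOf y0 w.1.1).κ w.1.2 :=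
      (κ_prim y0).comp (Primrec.fst.comp Primrec.fst) (Primrec.snd.comp Primrec.fst)
    have h2 : Primrec fun w : (CD n × Lt n) × Lt n => (cOf y0 w.1.1).κ w.2 :=
      (κ_prim y0).comp (Primrec.fst.comp Primrec.fst) Primrec.snd
    refine PrimrecPred.or (PrimrecPred.not ?_) ?_
    · exact Primrec.eq.comp h1 (Primrec.list_take.comp (Primrec.list_length.comp h1) h2)
    · exact Primrec.eq.comp (Primrec.snd.comp Primrec.fst) Primrec.snd

variable {m : ℕ}

/-- the bounded search -/
def Srch (tab : Fin m × Lt n → Wd n) (y0 : Lt n) (A : List (Lt n)) (z : Wd n × Wd n) : Prop :=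
  ∃ ms ∈ allL (List.finRange m) (allL A (z.1.length + z.2.length)).length,
    ∃ D ∈ allL (allL A (z.2.length + n)) (n + n), ∃ Y ∈ allL A n,
      gd y0 A (D, Y) ∧
      FreeGroup.reduce ((ms.foldl (stp tab) z.1).flatMap (cw y0 (D, Y))) = FreeGroup.reduce z.2

lemma foldl_prim (tab : Fin m × Lt n → Wd n) : Primrec₂ fun (ms : List (Fin m)) (W : Wd n) => ms.foldl (stp tab) W := by
  refine Primrec.list_foldl (f := fun z : List (Fin m) × Wd n => z.1) (g := fun z => z.2)
    (h := fun _ q => stp tab q.1 q.2) Primrec.fst Primrec.snd ?_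
  refine Primrec.list_flatMap (f := fun w : (List (Fin m) × Wd n) × (Wd n × Fin m) => w.2.1)
    (g := fun w p => tab (w.2.2, p)) (Primrec.fst.comp Primrec.snd) ?_
  exact (Primrec.dom_finite tab).comp (Primrec.pair (Primrec.snd.comp (Primrec.snd.comp Primrec.fst)) Primrec.snd)

lemma Srch_prim (tab : Fin m × Lt n → Wd n) (y0 : Lt n) (A : List (Lt n)) : PrimrecPred (Srch tab y0 A) := by
  refine exL (α := Wd n × Wd n) (β := List (Fin m)) (R := fun z ms => ∃ D ∈ allL (allL A (z.2.length + n)) (n + n), ∃ Y ∈ allL A n,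
      gd y0 A (D, Y) ∧
      FreeGroup.reduce ((ms.foldl (stp tab) z.1).flatMap (cw y0 (D, Y))) = FreeGroup.reduce z.2) ?_ ?_
  · refine exL (α := (Wd n × Wd n) × List (Fin m)) (β := List (Wd n)) (R := fun w D => ∃ Y ∈ allL A n,
      gd y0 A (D, Y) ∧
      FreeGroup.reduce ((w.2.foldl (stp tab) w.1.1).flatMap (cw y0 (D, Y))) = FreeGroup.reduce w.1.2) ?_ ?_
    · refine exL (α := ((Wd n × Wd n) × List (Fin m)) × List (Wd n)) (β := Wd n) (R := fun w Y => 
        gd y0 A (w.2, Y) ∧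
        FreeGroup.reduce ((w.1.2.foldl (stp tab) w.1.1.1).flatMap (cw y0 (w.2, Y))) = FreeGroup.reduce w.1.1.2) ?_ (Primrec.const _)
      have hq : Primrec fun v : (((Wd n × Wd n) × List (Fin m)) × List (Wd n)) × Wd n => (v.1.2, v.2) :=
        Primrec.pair (Primrec.snd.comp Primrec.fst) Primrec.snd
      refine PrimrecPred.and ((gd_prim y0 A).comp hq) (Primrec.eq.comp (reduce_prim.comp ?_) (reduce_prim.comp ?_))
      · refine Primrec.list_flatMap
          (f := fun v : (((Wd n × Wd n) × List (Fin m)) × List (Wd n)) × Wd n => v.1.1.2.foldl (stp tab) v.1.1.1.1)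
          (g := fun v p => cw y0 (v.1.2, v.2) p) ?_ ?_
        · exact (foldl_prim tab).comp (Primrec.snd.comp (Primrec.fst.comp Primrec.fst))
            (Primrec.fst.comp (Primrec.fst.comp (Primrec.fst.comp Primrec.fst)))
        · exact (cw_prim y0).comp (hq.comp Primrec.fst) Primrec.snd
      · exact Primrec.snd.comp (Primrec.fst.comp (Primrec.fst.comp Primrec.fst))
    · refine allL_prim.comp (allL_prim.comp (Primrec.const A) ?_) (Primrec.const _)
      exact Primrec.nat_add.comp (Primrec.list_length.comp (Primrec.snd.comp Primrec.fst)) (Primrec.const n)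
  · refine allL_prim.comp (Primrec.const _) (Primrec.list_length.comp (allL_prim.comp (Primrec.const A) ?_))
    exact Primrec.nat_add.comp (Primrec.list_length.comp Primrec.fst) (Primrec.list_length.comp Primrec.snd)

end prim
end MP


namespace MP

open FreeGroup hiding map_mul map_inv map_one
set_option linter.unusedSectionVars false

section final
variable {n m : ℕ}

lemma getD_ofFn {β : Type*} (f : Fin n → β) (i : Fin n) (d : β) : (List.ofFn f).getD i.val d = f i := by
  rw [List.getD_eq_getElem _ _ (by simp)]; simp

lemma cOf_surj (y0 : Lt n) (C : Code (Fin n) (Fin n)) :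
    cOf y0 (List.ofFn C.s ++ List.ofFn C.r, List.ofFn C.y) = C := by
  rcases C with ⟨s, r, y⟩
  simp only [cOf, Code.mk.injEq]
  refine ⟨?_, ?_, ?_⟩
  · funext i
    rw [List.getD_append _ _ _ _ (by simp), getD_ofFn]
  · funext i
    rw [List.getD_append_right _ _ _ _ (by simp)]
    simp only [List.length_ofFn, Nat.add_sub_cancel_left]
    exact getD_ofFn _ _ _
  · funext i
    exact getD_ofFn _ _ _

theorem Srch_iff (hn : 2 ≤ n) (T : Fin m → MulAut (FreeGroup (Fin n)))
    (hT : ∀ ω ∈ Om (Fin n), ∃ k, T k = ω) (y0 : Lt n) (A : List (Lt n)) (hA : ∀ x, x ∈ A) (U V : Wd n) :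
    Srch (fun q => (T q.1 (lt q.2)).toWord) y0 A (U, V) ↔
      ∃ f : FreeGroup (Fin n) →* FreeGroup (Fin n), Function.Injective f ∧
        f (FreeGroup.mk U) = FreeGroup.mk V := by
  constructor
  · rintro ⟨ms, -, D, -, Y, -, hg, he⟩
    obtain ⟨θ, hθ⟩ := foldl_aut T ms
    refine ⟨(cOf y0 (D, Y)).hom.comp θ.toMonoidHom, ?_, ?_⟩
    · exact ((cOf y0 (D, Y)).inj ((gd_iff y0 A hA _).1 hg)).comp θ.injective
    · have := congrArg FreeGroup.mk he
      rw [FreeGroup.reduce.self, FreeGroup.reduce.self, mk_flatMap (cOf y0 (D, Y)).hom _ (mk_cw y0 _), mk_foldl, hθ] at this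
      exact this
  · rintro ⟨f, hf, hUV⟩
    obtain ⟨θ, W, hWl, hθ, C, hC, hCl, hCV⟩ := forward hn U V f hf hUV
    obtain ⟨ms, hms, hW⟩ := exists_ms T hT A hA U W θ hθ (U.length + V.length) (by omega) (by omega)
    refine ⟨ms, (mem_allL _ _ _).2 ⟨hms, fun x _ => List.mem_finRange x⟩,
      List.ofFn C.s ++ List.ofFn C.r, (mem_allL _ _ _).2 ⟨by simp, ?_⟩,
      List.ofFn C.y, (mem_allL _ _ _).2 ⟨by simp, fun x _ => hA x⟩, ?_, ?_⟩
    · intro w hw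
      rw [mem_allL]
      refine ⟨?_, fun x _ => hA x⟩
      rw [List.mem_append, List.mem_ofFn, List.mem_ofFn] at hw
      rcases hw with ⟨i, rfl⟩ | ⟨i, rfl⟩
      · exact (hCl i).1
      · exact (hCl i).2
    · rw [gd_iff y0 A hA, cOf_surj]; exact hC
    · apply FreeGroup.reduce.sound
      rw [mk_flatMap (cOf y0 _).hom _ (mk_cw y0 _), mk_foldl, cOf_surj, ← hW, hCV]

theorem main (hn : 2 ≤ n) : ∃ d : Wd n → Wd n → Bool, Computable₂ d ∧ ∀ U V, d U V = true ↔
    ∃ f : FreeGroup (Fin n) →* FreeGroup (Fin n), Function.Injective f ∧ f (FreeGroup.mk U) = FreeGroup.mk V := by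
  obtain ⟨m, T, hT⟩ := exists_moves (Fin n)
  let y0 : Lt n := (⟨0, by omega⟩, true)
  let A : List (Lt n) := Finset.univ.toList
  obtain ⟨hd, hp⟩ := Srch_prim (fun q => (T q.1 (lt q.2)).toWord) y0 A
  refine ⟨fun U V => decide (Srch (fun q => (T q.1 (lt q.2)).toWord) y0 A (U, V)), hp.to_comp, fun U V => ?_⟩
  rw [decide_eq_true_iff]
  exact Srch_iff hn T hT y0 A (fun x => by simp [A]) U V

end final
end MP

/-- Theorem 3.1 of Ciobanu–Ould Houcine: the monomorphism problem in the free
group of rank `n ≥ 2` is decidable — there is a computable function on words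
deciding whether some injective endomorphism sends `u` to `v`. -/
theorem monomorphism_problem_decidable (n : ℕ) (hn : 2 ≤ n) :
    ∃ d : List (Fin n × Bool) → List (Fin n × Bool) → Bool,
      Computable₂ d ∧
      ∀ U V : List (Fin n × Bool),
        d U V = true ↔
          ∃ f : FreeGroup (Fin n) →* FreeGroup (Fin n),
            Function.Injective f ∧ f (FreeGroup.mk U) = FreeGroup.mk V := by
  exact MP.main hn
end

section
/- Let n ≥ 2, let F = FreeGroup (Fin n), and let H be a subgroup of F of rank m < n, i.e., H = Subgroup.closure (Set.range a) for some a : Fin m → F such that FreeGroup.lift a : FreeGroup (Fin m) →* F is injective. Then there exist elements c : Fin (n − m) → F such that the subgroup generated by H together with the c's is free of rank n; precisely, there exists b : Fin n → F with FreeGroup.lift b : FreeGroup (Fin n) →* F injective and Subgroup.closure (Set.range b) = Subgroup.closure (Set.range a ∪ Set.range c). -/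
open Monoid in
theorem coprodI_inj {ι : Type} {M N : ι → Type} [∀ i, Group (M i)] [∀ i, Group (N i)]
    (f : ∀ i, M i →* N i) (hf : ∀ i, Function.Injective (f i)) :
    Function.Injective (CoprodI.lift (fun i => (CoprodI.of (M := N) (i := i)).comp (f i))) := by
  classical
  rw [injective_iff_map_eq_one]
  intro x hx
  let w := CoprodI.Word.equiv x
  have hw : w.prod = x := CoprodI.Word.equiv.symm_apply_apply x
  let w' : CoprodI.Word N :=
    { toList := w.toList.map (fun p => ⟨p.1, f p.1 p.2⟩)
      ne_one := by
        intro l hl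
        obtain ⟨p, hp, rfl⟩ := List.mem_map.1 hl
        intro h
        exact w.ne_one p hp (hf _ (by simpa using h))
      chain_ne := by
        rw [List.isChain_map]
        exact w.chain_ne }
  have hw' : w'.prod = 1 := by
    rw [← hx, ← hw]
    simp only [CoprodI.Word.prod, w', map_list_prod, List.map_map]
    congr 1
    try
      apply List.map_congr_left
      intro p _
      simp
  have h2 : w' = CoprodI.Word.empty := by
    apply CoprodI.Word.equiv.symm.injective
    change w'.prod = CoprodI.Word.empty.prod
    rw [hw', CoprodI.Word.prod_empty]
  have h3 : w.toList = [] := by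
    have : w'.toList = [] := by rw [h2]; rfl
    simpa [w'] using this
  rw [← hw]
  simp [CoprodI.Word.prod, h3]

open Monoid in
theorem key_free {G : Type} [Group G] {S : Bool → Type} (A : ∀ b, S b → G)
    (hA : ∀ b, Function.Injective (FreeGroup.lift (A b))) :
    Function.Injective (FreeGroup.lift (fun p : (Σ b, S b) =>
      (CoprodI.of (M := fun _ : Bool => G) (i := p.1) (A p.1 p.2)))) := by
  let j : FreeGroup (Σ b, S b) →* CoprodI (fun b => FreeGroup (S b)) :=
    FreeGroup.lift (fun p => CoprodI.of (M := fun b => FreeGroup (S b)) (i := p.1) (FreeGroup.of p.2))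
  let k : CoprodI (fun b => FreeGroup (S b)) →* FreeGroup (Σ b, S b) :=
    CoprodI.lift (fun b => FreeGroup.lift (fun s => FreeGroup.of ⟨b, s⟩))
  have hkj : k.comp j = MonoidHom.id _ := by
    ext p
    simp [k, j]
  have hj : Function.Injective j := by
    apply Function.LeftInverse.injective (g := k)
    intro x
    exact DFunLike.congr_fun hkj x
  have := (coprodI_inj (M := fun b => FreeGroup (S b)) (N := fun _ : Bool => G)
    (fun b => FreeGroup.lift (A b)) hA).comp hj
  have e : (CoprodI.lift (fun i => (CoprodI.of (M := fun _ : Bool => G) (i := i)).comp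
      (FreeGroup.lift (A i)))).comp j = (FreeGroup.lift (fun p : (Σ b, S b) =>
      (CoprodI.of (M := fun _ : Bool => G) (i := p.1) (A p.1 p.2)))) := by
    ext p
    simp [j]
  rw [← e]
  exact this

theorem exists_dir (n m : ℕ) (hm : m < n) (a : Fin m → FreeGroup (Fin n)) :
    ∃ d : Fin n → ℤ, d ≠ 0 ∧
      ∀ j, FreeGroup.lift (fun i => Multiplicative.ofAdd (d i)) (a j) = 1 := by
  let T : (Fin n → ℤ) →+ (Fin m → ℤ) :=
    AddMonoidHom.mk' (fun d j =>
      Multiplicative.toAdd (FreeGroup.lift (fun i => Multiplicative.ofAdd (d i)) (a j))) (by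
        intro d e
        funext j
        have : FreeGroup.lift (fun i => Multiplicative.ofAdd ((d + e) i)) =
          FreeGroup.lift (fun i => Multiplicative.ofAdd (d i)) *
          FreeGroup.lift (fun i => Multiplicative.ofAdd (e i)) := by
          ext i
          simp
        simp only [this]
        rfl)
  by_contra! h
  have hi : Function.Injective T.toIntLinearMap := by
    rw [← LinearMap.ker_eq_bot, LinearMap.ker_eq_bot']
    intro d hd
    by_contra h0
    obtain ⟨j, hj⟩ := h d h0
    exact hj (congrFun hd j)
  have := card_le_of_injective ℤ T.toIntLinearMap hi
  simp at this
  omega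

def shiftHom (I : Type) : Multiplicative ℤ →* MulAut (FreeGroup (ℤ × I)) where
  toFun k := FreeGroup.freeGroupCongr ((Equiv.addRight (Multiplicative.toAdd k)).prodCongr (Equiv.refl I))
  map_one' := by
    apply MulEquiv.toMonoidHom_injective
    ext p
    simp
  map_mul' a b := by
    apply MulEquiv.toMonoidHom_injective
    ext p
    rcases p with ⟨z, i⟩
    simp
    ring

theorem shiftHom_of (I : Type) (k : Multiplicative ℤ) (p : ℤ × I) :
    shiftHom I k (FreeGroup.of p) = FreeGroup.of (p.1 + Multiplicative.toAdd k, p.2) := by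
  rcases p with ⟨z, i⟩
  simp [shiftHom]

def psi {I : Type} (d : I → ℤ) :
    FreeGroup I →* FreeGroup (ℤ × I) ⋊[shiftHom I] Multiplicative ℤ :=
  FreeGroup.lift (fun i => ⟨FreeGroup.of (0, i), Multiplicative.ofAdd (d i)⟩)

theorem psi_inj {I : Type} (d : I → ℤ) : Function.Injective (psi d) := by
  let r : FreeGroup (ℤ × I) ⋊[shiftHom I] Multiplicative ℤ →* FreeGroup I :=
    SemidirectProduct.lift (FreeGroup.map Prod.snd) 1 (by
      intro g
      ext p
      simp [shiftHom_of])
  have : r.comp (psi d) = MonoidHom.id _ := by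
    ext i
    simp [psi, r, SemidirectProduct.lift]
  apply Function.LeftInverse.injective (g := r)
  intro x
  exact DFunLike.congr_fun this x

theorem psi_right {I : Type} (d : I → ℤ) (g : FreeGroup I) :
    (psi d g).right = FreeGroup.lift (fun i => Multiplicative.ofAdd (d i)) g := by
  have : SemidirectProduct.rightHom.comp (psi d) =
      FreeGroup.lift (fun i => Multiplicative.ofAdd (d i)) := by
    ext i
    simp [psi]
  exact DFunLike.congr_fun this g

def col {I : Type} (x : I) : Subgroup (FreeGroup (ℤ × I)) :=
  Subgroup.closure (Set.range fun k : ℤ => FreeGroup.of (k, x))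

theorem col_shift {I : Type} (x : I) (k : Multiplicative ℤ) {g : FreeGroup (ℤ × I)}
    (hg : g ∈ col x) : shiftHom I k g ∈ col x := by
  induction hg using Subgroup.closure_induction with
  | mem g h =>
    obtain ⟨z, rfl⟩ := h
    simp only [shiftHom_of]
    exact Subgroup.subset_closure ⟨_, rfl⟩
  | one => simpa using (col x).one_mem
  | mul a b _ _ ha hb => rw [map_mul]; exact (col x).mul_mem ha hb
  | inv a _ ha => rw [map_inv]; exact (col x).inv_mem ha

theorem psi_pow_left {I : Type} (d : I → ℤ) (x : I) (K : ℕ) :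
    (psi d (FreeGroup.of x ^ K)).left ∈ col x := by
  induction K with
  | zero => simpa using (col x).one_mem
  | succ K ih =>
    rw [pow_succ, map_mul, SemidirectProduct.mul_left]
    refine (col x).mul_mem ih (col_shift x _ ?_)
    simp only [psi, FreeGroup.lift_apply_of]
    exact Subgroup.subset_closure ⟨_, rfl⟩

theorem supp_bound {I : Type} (g : FreeGroup (ℤ × I)) : ∃ B : ℕ, ∀ B' : ℕ, B ≤ B' →
    g ∈ Subgroup.closure (FreeGroup.of '' {p : ℤ × I | |p.1| < B'}) := by
  induction g using FreeGroup.induction_on with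
  | C1 => exact ⟨0, fun _ _ => Subgroup.one_mem _⟩
  | of p =>
    refine ⟨p.1.natAbs + 1, fun B' h => Subgroup.subset_closure ⟨p, ?_, rfl⟩⟩
    change |p.1| < (B' : ℤ)
    rw [Int.abs_eq_natAbs]
    omega
  | inv_of p ih =>
    obtain ⟨B, h⟩ := ih
    exact ⟨B, fun B' hB => Subgroup.inv_mem _ (h B' hB)⟩
  | mul a b ha hb =>
    obtain ⟨B, h⟩ := ha
    obtain ⟨C, h'⟩ := hb
    exact ⟨max B C, fun B' hB => Subgroup.mul_mem _ (h B' (by omega)) (h' B' (by omega))⟩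

theorem psi_comm_left {I : Type} (d : I → ℤ) (x y : I) (K : ℕ) :
    (psi d (FreeGroup.of x ^ K * FreeGroup.of y * (FreeGroup.of x ^ K)⁻¹ * (FreeGroup.of y)⁻¹)).left
    = (psi d (FreeGroup.of x ^ K)).left * FreeGroup.of ((K : ℤ) * d x, y) *
      (shiftHom I (Multiplicative.ofAdd (d y)) (psi d (FreeGroup.of x ^ K)).left⁻¹ *
        (FreeGroup.of (0, y))⁻¹) := by
  have hr : (psi d (FreeGroup.of x ^ K)).right = Multiplicative.ofAdd ((K : ℤ) * d x) := by
    rw [psi_right, map_pow, FreeGroup.lift_apply_of, ← ofAdd_nsmul]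
    simp
  have hy : psi d (FreeGroup.of y) = ⟨FreeGroup.of (0, y), Multiplicative.ofAdd (d y)⟩ := by
    simp [psi]
  simp only [map_mul (psi d), map_inv (psi d), SemidirectProduct.mul_left,
    SemidirectProduct.mul_right, SemidirectProduct.inv_left, SemidirectProduct.inv_right, hr, hy,
    shiftHom_of, map_inv, ← MulAut.mul_apply, ← map_mul]
  simp [mul_assoc, mul_comm, shiftHom_of, ← ofAdd_add, ← ofAdd_neg]

open Monoid in
/-- main construction -/
theorem main_constr (n : ℕ) (hn : 2 ≤ n) (m l : ℕ) (hm : m < n)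
    (a : Fin m → FreeGroup (Fin n))
    (ha : Function.Injective (FreeGroup.lift a)) :
    ∃ c : Fin l → FreeGroup (Fin n), Function.Injective (FreeGroup.lift (Sum.elim a c)) := by
  classical
  obtain ⟨d, hd, hda⟩ := exists_dir n m hm a
  obtain ⟨x, hx⟩ : ∃ x, d x ≠ 0 := Function.ne_iff.1 hd
  haveI : Nontrivial (Fin n) := Fin.nontrivial_iff_two_le.2 hn
  obtain ⟨y, hyx⟩ := exists_ne x
  choose Bf hBf using fun j => supp_bound (psi d (a j)).left
  obtain ⟨B, hB1, hB⟩ : ∃ B : ℕ, 1 ≤ B ∧ ∀ j, Bf j ≤ B :=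
    ⟨Finset.univ.sup Bf + 1, by omega, fun j =>
      (Finset.le_sup (f := Bf) (Finset.mem_univ j)).trans (by omega)⟩
  let c : Fin l → FreeGroup (Fin n) := fun j =>
    FreeGroup.of x ^ (B + j) * FreeGroup.of y * (FreeGroup.of x ^ (B + j : ℕ))⁻¹ * (FreeGroup.of y)⁻¹
  let L : Fin l → ℤ × Fin n := fun j => (((B + j : ℕ) : ℤ) * d x, y)
  have hLinj : Function.Injective L := by
    intro i j h
    simp only [L, Prod.mk.injEq, and_true] at h
    have := mul_right_cancel₀ hx h
    ext
    push_cast at this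
    omega
  have hLbig : ∀ j, (B : ℤ) ≤ |(L j).1| := by
    intro j
    simp only [L, abs_mul]
    have h1 : 1 ≤ |d x| := Int.one_le_abs hx
    have h2 : (B : ℤ) ≤ |((B + j : ℕ) : ℤ)| := by
      rw [Nat.abs_cast]; push_cast; omega
    nlinarith [abs_nonneg (((B + j : ℕ) : ℤ))]
  let al : Fin l → FreeGroup (ℤ × Fin n) := fun j => (psi d (FreeGroup.of x ^ (B + j : ℕ))).left
  let be : Fin l → FreeGroup (ℤ × Fin n) := fun j =>
    (shiftHom (Fin n) (Multiplicative.ofAdd (d y)) (al j)⁻¹ * (FreeGroup.of (0, y))⁻¹)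
  have hcl : ∀ j, (psi d (c j)).left = al j * FreeGroup.of (L j) * be j := fun j =>
    psi_comm_left d x y _
  let G := FreeGroup (ℤ × Fin n)
  let P := CoprodI (fun _ : Bool => G)
  let i1 : G →* P := CoprodI.of (M := fun _ : Bool => G) (i := true)
  let i2 : G →* P := CoprodI.of (M := fun _ : Bool => G) (i := false)
  let Θ : G →* P := FreeGroup.lift (fun p =>
    if h : ∃ j, L j = p then i1 (al h.choose)⁻¹ * i2 (FreeGroup.of p) * i1 (be h.choose)⁻¹
    else i1 (FreeGroup.of p))
  have hΘ1 : ∀ p, (¬ ∃ j, L j = p) → Θ (FreeGroup.of p) = i1 (FreeGroup.of p) := by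
    intro p hp
    exact (FreeGroup.lift_apply_of ..).trans (dif_neg hp)
  have hΘ2 : ∀ j, Θ (FreeGroup.of (L j)) =
      i1 (al j)⁻¹ * i2 (FreeGroup.of (L j)) * i1 (be j)⁻¹ := by
    intro j
    have h : ∃ j', L j' = L j := ⟨j, rfl⟩
    have hc : h.choose = j := hLinj h.choose_spec
    refine (FreeGroup.lift_apply_of ..).trans ((dif_pos h).trans ?_)
    rw [hc]
  have hΘcol : ∀ g ∈ col x, Θ g = i1 g := by
    intro g hg
    refine MonoidHom.eqOn_closure (f := Θ) (g := i1) ?_ hg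
    rintro _ ⟨k, rfl⟩
    apply hΘ1
    rintro ⟨j, hj⟩
    exact hyx (congrArg Prod.snd hj)
  have hΘa : ∀ j, Θ (psi d (a j)).left = i1 (psi d (a j)).left := by
    intro j
    refine MonoidHom.eqOn_closure (f := Θ) (g := i1) ?_ (hBf j B (hB j))
    rintro _ ⟨p, hp, rfl⟩
    apply hΘ1
    rintro ⟨j, rfl⟩
    exact absurd hp (not_lt.2 (hLbig j))
  have hal : ∀ j, Θ (al j) = i1 (al j) := fun j => hΘcol _ (psi_pow_left d x _)
  have hbe : ∀ j, Θ (be j) = i1 (be j) := by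
    intro j
    simp only [be, map_mul]
    congr 1
    · exact hΘcol _ (col_shift x _ ((col x).inv_mem (psi_pow_left d x _)))
    · rw [map_inv, map_inv, hΘ1]
      rintro ⟨j, hj⟩
      have := hLbig j
      rw [hj] at this
      simp at this
      omega
  have hΘc : ∀ j, Θ (psi d (c j)).left = i2 (FreeGroup.of (L j)) := by
    intro j
    rw [hcl, map_mul, map_mul, hal, hbe, hΘ2]
    simp [mul_assoc]
  have har : ∀ j, (psi d (a j)).right = 1 := fun j => by rw [psi_right, hda]
  have hcr : ∀ j, (psi d (c j)).right = 1 := fun j => by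
    rw [psi_right]; simp [c]
  let A : Fin m → G := fun j => (psi d (a j)).left
  have hA : Function.Injective (FreeGroup.lift A) := by
    have e : SemidirectProduct.inl.comp (FreeGroup.lift A) = (psi d).comp (FreeGroup.lift a) := by
      ext j
      · simp [A]
      · simp [har]
    have h2 : Function.Injective ((psi d).comp (FreeGroup.lift a)) := (psi_inj d).comp ha
    rw [← e] at h2
    exact Function.Injective.of_comp (f := SemidirectProduct.inl) h2
  have hL : Function.Injective (FreeGroup.lift (fun j => (FreeGroup.of (L j) : G))) := by
    have : FreeGroup.lift (fun j => (FreeGroup.of (L j) : G)) = FreeGroup.map L := by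
      ext j; simp
    rw [this]
    exact FreeGroup.map_injective hLinj
  let S : Bool → Type := fun b => Bool.rec (Fin l) (Fin m) b
  let AA : ∀ b, S b → G := fun b => match b with
    | true => A
    | false => fun j => FreeGroup.of (L j)
  have hAA : ∀ b, Function.Injective (FreeGroup.lift (AA b)) := by
    intro b
    cases b
    · exact hL
    · exact hA
  have hfin := key_free AA hAA
  let q : Fin m ⊕ Fin l → Σ b, S b := Sum.elim (fun j => ⟨true, j⟩) (fun j => ⟨false, j⟩)
  have hq : Function.Injective q := by
    rintro (i | i) (j | j) h
    · simp only [q, Sum.elim_inl, Sigma.mk.injEq, heq_eq_eq, true_and] at h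
      rw [h]
    · simp [q] at h
    · simp [q] at h
    · simp only [q, Sum.elim_inr, Sigma.mk.injEq, heq_eq_eq, true_and] at h
      rw [h]
  refine ⟨c, ?_⟩
  let Lf : FreeGroup (Fin m ⊕ Fin l) →* G := FreeGroup.lift (fun s => (psi d (Sum.elim a c s)).left)
  have e1 : (psi d).comp (FreeGroup.lift (Sum.elim a c)) = SemidirectProduct.inl.comp Lf := by
    ext s
    · simp [Lf]
    · rcases s with j | j
      · simp [har]
      · simp [hcr]
  have e2 : Θ.comp Lf = (FreeGroup.lift (fun p : (Σ b, S b) =>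
      (CoprodI.of (M := fun _ : Bool => G) (i := p.1) (AA p.1 p.2)))).comp (FreeGroup.map q) := by
    ext s
    rcases s with j | j
    · simpa [Lf, q] using hΘa j
    · simpa [Lf, q] using hΘc j
  have h3 : Function.Injective (Θ.comp Lf) := by
    rw [e2]
    exact hfin.comp (FreeGroup.map_injective hq)
  have h4 : Function.Injective Lf := Function.Injective.of_comp h3
  have h5 : Function.Injective ((psi d).comp (FreeGroup.lift (Sum.elim a c))) := by
    rw [e1]
    exact SemidirectProduct.inl_injective.comp h4
  exact Function.Injective.of_comp h5

/-- Lemma 2.4 of Ciobanu–Ould Houcine: a subgroup of rank `m < n` of the free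
group of rank `n ≥ 2` can be extended by `n - m` elements to a subgroup of
rank `n`. -/
theorem extend_to_rank_n (n : ℕ) (hn : 2 ≤ n) (m : ℕ) (hm : m < n)
    (a : Fin m → FreeGroup (Fin n))
    (ha : Function.Injective (FreeGroup.lift a))
    (H : Subgroup (FreeGroup (Fin n)))
    (hH : H = Subgroup.closure (Set.range a)) :
    ∃ c : Fin (n - m) → FreeGroup (Fin n),
      ∃ b : Fin n → FreeGroup (Fin n),
        Function.Injective (FreeGroup.lift b) ∧
        Subgroup.closure (Set.range b) =
          Subgroup.closure (Set.range a ∪ Set.range c) := by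
  obtain ⟨c, hc⟩ := main_constr n hn m (n - m) hm a ha
  let e : Fin n ≃ Fin m ⊕ Fin (n - m) :=
    (finCongr (by omega : n = m + (n - m))).trans finSumFinEquiv.symm
  refine ⟨c, Sum.elim a c ∘ e, ?_, ?_⟩
  · have : FreeGroup.lift (Sum.elim a c ∘ e) =
        (FreeGroup.lift (Sum.elim a c)).comp (FreeGroup.map e) := by
      ext i
      simp
    rw [this]
    exact hc.comp (FreeGroup.map_injective e.injective)
  · rw [e.surjective.range_comp, Set.Sum.elim_range]
end

section
/- Let n ≥ 2 and let H be a subgroup of FreeGroup (Fin n) of finite index (H.index ≠ 0). Then every generating set of H has at least n elements: for every finite set S ⊆ FreeGroup (Fin n) with Subgroup.closure S = H, the cardinality of S is at least n. -/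
/-- The index-formula claim inside Lemma 2.4 of Ciobanu–Ould Houcine: a
finite-index subgroup of the free group of rank `n ≥ 2` cannot be generated
by fewer than `n` elements. -/
theorem finite_index_subgroup_rank_ge (n : ℕ) (hn : 2 ≤ n)
    (H : Subgroup (FreeGroup (Fin n))) (hH : H.index ≠ 0) :
    ∀ S : Finset (FreeGroup (Fin n)),
      Subgroup.closure (S : Set (FreeGroup (Fin n))) = H → n ≤ S.card := by
  classical
  intro S hS
  let f : FreeGroup (Fin n) →* Multiplicative (Fin n → ℚ) :=
    FreeGroup.lift (fun i => Multiplicative.ofAdd (Pi.single i (1 : ℚ)))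
  let T : Finset (Fin n → ℚ) := S.image (fun s => (f s).toAdd)
  let W : Submodule ℚ (Fin n → ℚ) := Submodule.span ℚ (T : Set (Fin n → ℚ))
  have hW : ∀ h ∈ H, (f h).toAdd ∈ W := by
    intro h hh
    rw [← hS] at hh
    induction hh using Subgroup.closure_induction with
    | mem x hx =>
      exact Submodule.subset_span (Finset.mem_coe.2 (Finset.mem_image_of_mem _ hx))
    | one => simp
    | mul x y _ _ hx hy => rw [map_mul, toAdd_mul]; exact W.add_mem hx hy
    | inv x _ hx => rw [map_inv, toAdd_inv]; exact W.neg_mem hx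
  have hb : ∀ i, (Pi.single i (1 : ℚ) : Fin n → ℚ) ∈ W := by
    intro i
    obtain ⟨k, hk, -, hm⟩ := Subgroup.exists_pow_mem_of_index_ne_zero hH (FreeGroup.of i)
    have h1 := hW _ hm
    have hf : f (FreeGroup.of i) = Multiplicative.ofAdd (Pi.single i (1 : ℚ)) :=
      FreeGroup.lift_apply_of
    rw [map_pow, hf, toAdd_pow, toAdd_ofAdd, ← Nat.cast_smul_eq_nsmul ℚ] at h1
    exact (W.smul_mem_iff (Nat.cast_ne_zero.2 hk.ne')).1 h1
  have htop : W = ⊤ := by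
    rw [eq_top_iff, ← (Pi.basisFun ℚ (Fin n)).span_eq, Submodule.span_le]
    rintro _ ⟨i, rfl⟩
    simpa using hb i
  have h2 : Module.finrank ℚ W ≤ T.card := finrank_span_finset_le_card T
  rw [htop, finrank_top, Module.finrank_fin_fun] at h2
  exact h2.trans Finset.card_image_le
end

section
/- Let n ≥ 2 and let F = FreeGroup (Fin n). Every finitely generated subgroup H of F has a free basis consisting of 'minimal' elements: there exist m : ℕ and b : Fin m → F such that FreeGroup.lift b : FreeGroup (Fin m) →* F is injective with range equal to H, and for every w : FreeGroup (Fin m) and every index i : Fin m that occurs in the reduced word of w (i.e., (i, s) ∈ w.toWord for some s : Bool), one has |(FreeGroup.lift b) w| ≥ |b i|. -/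
namespace MinBasis

open FreeGroup hiding map_one map_mul map_inv norm_eq_zero norm_one norm_mul_le IsReduced

variable {α : Type} [DecidableEq α]

theorem tree (H : Subgroup (FreeGroup α)) :
    ∃ τ : (FreeGroup α ⧸ H) → FreeGroup α,
      (∀ x, τ x • ((1 : FreeGroup α) : FreeGroup α ⧸ H) = x) ∧
      (∀ g : FreeGroup α, (τ (g : FreeGroup α ⧸ H)).norm ≤ g.norm) ∧
      (∀ x, τ x = 1 ∨ ∃ l : α × Bool, τ x = mk [l] * τ ((mk [l])⁻¹ • x) ∧
        (τ ((mk [l])⁻¹ • x)).norm < (τ x).norm) := by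
  classical
  have hex : ∀ x : FreeGroup α ⧸ H, ∃ k : ℕ, ∃ g : FreeGroup α,
      (g : FreeGroup α ⧸ H) = x ∧ g.norm = k := by
    intro x
    obtain ⟨g, rfl⟩ := QuotientGroup.mk_surjective x
    exact ⟨_, g, rfl, rfl⟩
  let d : FreeGroup α ⧸ H → ℕ := fun x => Nat.find (hex x)
  have hd1 : ∀ x, ∃ g : FreeGroup α, (g : FreeGroup α ⧸ H) = x ∧ g.norm = d x :=
    fun x => Nat.find_spec (hex x)
  have hd2 : ∀ g : FreeGroup α, d (g : FreeGroup α ⧸ H) ≤ g.norm :=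
    fun g => Nat.find_min' (hex _) ⟨g, rfl, rfl⟩
  clear_value d
  let τ : (FreeGroup α ⧸ H) → FreeGroup α := (measure d).wf.fix (fun x ih =>
    if h : ∃ l : α × Bool, d ((mk [l])⁻¹ • x) < d x
      then mk [h.choose] * ih _ h.choose_spec else 1)
  have hτ : ∀ x, τ x = if h : ∃ l : α × Bool, d ((mk [l])⁻¹ • x) < d x
      then mk [h.choose] * τ ((mk [h.choose])⁻¹ • x) else 1 := by
    intro x
    exact (measure d).wf.fix_eq _ x
  clear_value τ
  have hstep : ∀ x, 0 < d x → ∃ l : α × Bool, d ((mk [l])⁻¹ • x) < d x := by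
    intro x hx
    obtain ⟨g, rfl, hg⟩ := hd1 x
    rcases hL : g.toWord with _ | ⟨l, L⟩
    · simp [FreeGroup.norm, hL] at hg
      omega
    · have h1 : g = mk [l] * mk L := by
        rw [← mk_toWord (x := g), hL, mul_mk]; rfl
      refine ⟨l, ?_⟩
      have h2 : (mk [l])⁻¹ • (g : FreeGroup α ⧸ H) = ((mk L : FreeGroup α) : FreeGroup α ⧸ H) := by
        rw [MulAction.Quotient.smul_coe, smul_eq_mul, h1, inv_mul_cancel_left]
      rw [h2]
      have h3 := hd2 (mk L)
      have h4 : (mk L).norm ≤ L.length := norm_mk_le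
      have h5 : g.norm = L.length + 1 := by simp [FreeGroup.norm, hL]
      omega
  have hmain : ∀ k x, d x = k →
      τ x • ((1 : FreeGroup α) : FreeGroup α ⧸ H) = x ∧ (τ x).norm ≤ d x := by
    intro k
    induction k using Nat.strong_induction_on with
    | _ k ih =>
      intro x hx
      by_cases h : ∃ l : α × Bool, d ((mk [l])⁻¹ • x) < d x
      · have h1 := hτ x
        rw [dif_pos h] at h1
        have h2 := h.choose_spec
        generalize h.choose = l at h1 h2
        obtain ⟨h3, h4⟩ := ih _ (hx ▸ h2) _ rfl
        constructor
        · rw [h1, mul_smul, h3, smul_inv_smul]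
        · rw [h1]
          have h5 := FreeGroup.norm_mul_le (mk [l]) (τ ((mk [l])⁻¹ • x))
          have h6 : (mk [l]).norm ≤ 1 := norm_mk_le
          omega
      · have h1 := hτ x
        rw [dif_neg h] at h1
        have h0 : d x = 0 := by
          by_contra h0
          exact h (hstep x (by omega))
        obtain ⟨g, hg, hg0⟩ := hd1 x
        rw [h0, FreeGroup.norm_eq_zero] at hg0
        subst hg0
        rw [h1]
        simp [hg]
  have heq : ∀ x, (τ x).norm = d x := by
    intro x
    obtain ⟨h1, h2⟩ := hmain _ x rfl
    refine le_antisymm h2 ?_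
    have h3 := hd2 (τ x)
    rw [MulAction.Quotient.smul_coe, smul_eq_mul, mul_one] at h1
    rwa [h1] at h3
  refine ⟨τ, fun x => (hmain _ x rfl).1, fun g => (heq _).trans_le (hd2 g), fun x => ?_⟩
  by_cases h : ∃ l : α × Bool, d ((mk [l])⁻¹ • x) < d x
  · right
    have h1 := hτ x
    rw [dif_pos h] at h1
    refine ⟨_, h1, ?_⟩
    rw [heq, heq]
    exact h.choose_spec
  · left
    rw [hτ x, dif_neg h]

theorem finite_of_fg {E : Type} (h : Group.FG (FreeGroup E)) : Finite E := by
  classical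
  obtain ⟨S, hS⟩ := Group.fg_def.mp h
  let U : Set E := ⋃ g ∈ S, {e | ∃ p ∈ g.toWord, p.1 = e}
  have hU : U.Finite := by
    refine Set.Finite.biUnion S.finite_toSet fun g _ => ?_
    refine ((g.toWord.map Prod.fst).toFinset.finite_toSet).subset ?_
    rintro e ⟨p, hp, rfl⟩
    exact List.mem_toFinset.mpr (List.mem_map_of_mem hp)
  let K : Subgroup (FreeGroup E) :=
    { carrier := {w | ∀ p ∈ w.toWord, p.1 ∈ U}
      one_mem' := by simp
      mul_mem' := by
        intro a b ha hb p hp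
        have := (toWord_mul_sublist a b).subset hp
        rcases List.mem_append.mp this with h | h
        · exact ha p h
        · exact hb p h
      inv_mem' := by
        intro a ha p hp
        rw [toWord_inv] at hp
        simp only [invRev, List.mem_reverse, List.mem_map] at hp
        obtain ⟨q, hq, rfl⟩ := hp
        exact ha q hq }
  have hK : K = ⊤ := by
    rw [eq_top_iff, ← hS, Subgroup.closure_le]
    intro g hg p hp
    exact Set.mem_biUnion hg ⟨p, hp, rfl⟩
  have : U = Set.univ := by
    ext e
    simp only [Set.mem_univ, iff_true]
    have : of e ∈ K := hK ▸ Subgroup.mem_top _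
    exact this (e, true) (by simp)
  rw [this] at hU
  exact Set.finite_univ_iff.mp hU

theorem toWord_map_equiv {β γ : Type} [DecidableEq β] [DecidableEq γ] (f : β ≃ γ)
    (w : FreeGroup β) (i : β) (s : Bool) (h : (i, s) ∈ w.toWord) :
    (f i, s) ∈ (FreeGroup.map f w).toWord := by
  have h1 : (FreeGroup.map f w).toWord = w.toWord.map (fun p => (f p.1, p.2)) := by
    conv_lhs => rw [← mk_toWord (x := w)]
    rw [map.mk, toWord_mk]
    apply FreeGroup.IsReduced.reduce_eq
    have := isReduced_toWord (x := w)
    unfold FreeGroup.IsReduced at this ⊢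
    rw [List.isChain_map]
    simpa using this
  rw [h1]
  exact List.mem_map_of_mem h

theorem basis (H : Subgroup (FreeGroup α)) :
    ∃ (E : Type) (_ : DecidableEq E) (b : E → FreeGroup α),
      Function.Injective (FreeGroup.lift b) ∧ (FreeGroup.lift b).range = H ∧
      ∀ w : FreeGroup E, ∀ i : E, (∃ s : Bool, (i, s) ∈ w.toWord) →
          (b i).norm ≤ ((FreeGroup.lift b) w).norm := by
  classical
  obtain ⟨τ, hτ1, hτ2, hτ3⟩ := tree H
  set o : FreeGroup α ⧸ H := ((1 : FreeGroup α) : FreeGroup α ⧸ H) with ho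
  have ho1 : τ o = 1 := by
    have := hτ2 1
    rw [FreeGroup.norm_one] at this
    exact FreeGroup.norm_eq_zero.mp (Nat.le_zero.mp this)
  have hsm : ∀ g : FreeGroup α, (g : FreeGroup α ⧸ H) = g • o := by
    intro g
    rw [ho, MulAction.Quotient.smul_coe, smul_eq_mul, mul_one]
  have hmem : ∀ g : FreeGroup α, g ∈ H ↔ g • o = o := by
    intro g
    rw [← hsm, ho, eq_comm, QuotientGroup.eq]
    simp
  have hτ2' : ∀ g : FreeGroup α, (τ (g • o)).norm ≤ g.norm := fun g => hsm g ▸ hτ2 g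
  let B : (FreeGroup α ⧸ H) × α → FreeGroup α := fun p =>
    (τ (of p.2 • p.1))⁻¹ * of p.2 * τ p.1
  have hB : ∀ x a, B (x, a) = (τ (of a • x))⁻¹ * of a * τ x := fun _ _ => rfl
  let E : Type := {p : (FreeGroup α ⧸ H) × α // B p ≠ 1}
  let b : E → FreeGroup α := fun e => B e.1
  let ε : (FreeGroup α ⧸ H) → α → FreeGroup E := fun x a =>
    if h : B (x, a) ≠ 1 then of (⟨(x, a), h⟩ : E) else 1
  have hε : ∀ x a, FreeGroup.lift b (ε x a) = B (x, a) := by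
    intro x a
    by_cases h : B (x, a) ≠ 1
    · simp only [ε, dif_pos h, FreeGroup.lift_apply_of, b]
    · simp only [ε, dif_neg h, map_one]
      exact (not_not.mp h).symm
  let ψ : α → Equiv.Perm ((FreeGroup α ⧸ H) × FreeGroup E) := fun a =>
    { toFun := fun p => (of a • p.1, ε p.1 a * p.2)
      invFun := fun p => ((of a)⁻¹ • p.1, (ε ((of a)⁻¹ • p.1) a)⁻¹ * p.2)
      left_inv := by intro p; simp
      right_inv := by intro p; simp }
  let Φ : FreeGroup α →* Equiv.Perm ((FreeGroup α ⧸ H) × FreeGroup E) := FreeGroup.lift ψ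
  have hΦof : ∀ a p, Φ (of a) p = (of a • p.1, ε p.1 a * p.2) := by
    intro a p
    simp only [Φ, FreeGroup.lift_apply_of]; rfl
  have hΦinv : ∀ a p, Φ (of a)⁻¹ p = ((of a)⁻¹ • p.1, (ε ((of a)⁻¹ • p.1) a)⁻¹ * p.2) := by
    intro a p
    simp only [Φ, map_inv, FreeGroup.lift_apply_of]; rfl
  clear_value Φ
  have hcase : ∀ l : α × Bool, (∃ a, l = (a, true) ∧ mk [l] = of a) ∨
      (∃ a, l = (a, false) ∧ mk [l] = (of a)⁻¹) := by
    rintro ⟨a, _ | _⟩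
    · right; exact ⟨a, rfl, rfl⟩
    · left; exact ⟨a, rfl, rfl⟩
  -- tree words act trivially
  have htree : ∀ k x u, (τ x).norm = k → Φ (τ x) (o, u) = (x, u) := by
    intro k
    induction k using Nat.strong_induction_on with
    | _ k ih =>
      intro x u hx
      rcases hτ3 x with h | ⟨l, h1, h2⟩
      · have := hτ1 x
        rw [h, one_smul] at this
        rw [h, map_one, this]; rfl
      · have h3 := ih _ (hx ▸ h2) _ u rfl
        rw [h1, map_mul, Equiv.Perm.mul_apply, h3]
        rcases hcase l with ⟨a, -, hl⟩ | ⟨a, -, hl⟩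
        · rw [hl] at h1 ⊢
          rw [hΦof]
          have : B ((of a)⁻¹ • x, a) = 1 := by
            rw [hB, smul_inv_smul]
            rw [mul_assoc, ← h1]; simp
          have : ε ((of a)⁻¹ • x) a = 1 := dif_neg (not_not.mpr this)
          simp [this]
        · rw [hl] at h1 ⊢
          rw [hΦinv]
          simp only [inv_inv] at h1 ⊢
          have : B (x, a) = 1 := by
            rw [hB, h1]; simp
          have : ε x a = 1 := dif_neg (not_not.mpr this)
          simp [this]
  have hequiv : ∀ g p, τ (Φ g p).1 * FreeGroup.lift b (Φ g p).2
      = g * (τ p.1 * FreeGroup.lift b p.2) := by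
    intro g
    induction g using FreeGroup.induction_on with
    | C1 => intro p; simp
    | of a =>
      intro p
      change τ (Φ (of a) p).1 * FreeGroup.lift b (Φ (of a) p).2 = of a * _
      rw [hΦof]
      simp only [map_mul, hε, hB]; group
    | inv_of a _ =>
      intro p
      change τ (Φ (of a)⁻¹ p).1 * FreeGroup.lift b (Φ (of a)⁻¹ p).2 = (of a)⁻¹ * _
      rw [hΦinv]
      simp only [map_mul, map_inv, hε, hB, smul_inv_smul]; group
    | mul x y hx hy =>
      intro p
      rw [map_mul, Equiv.Perm.mul_apply, hx, hy]; group
  have hfst : ∀ g p, (Φ g p).1 = g • p.1 := by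
    intro g
    induction g using FreeGroup.induction_on with
    | C1 => intro p; simp
    | of a => intro p; exact congrArg Prod.fst (hΦof a p)
    | inv_of a _ => intro p; exact congrArg Prod.fst (hΦinv a p)
    | mul x y hx hy =>
      intro p
      rw [map_mul, Equiv.Perm.mul_apply, hx, hy, mul_smul]
  have hgen : ∀ e u, Φ (b e) (o, u) = (o, of e * u) := by
    rintro ⟨⟨x, a⟩, he⟩ u
    change Φ ((τ (of a • x))⁻¹ * of a * τ x) (o, u) = _
    rw [map_mul, map_mul, Equiv.Perm.mul_apply, Equiv.Perm.mul_apply, htree _ _ _ rfl, hΦof,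
      map_inv, Equiv.Perm.inv_eq_iff_eq, htree _ _ _ rfl]
    have : ε x a = of (⟨(x, a), he⟩ : E) := dif_pos he
    rw [this]
  have hw : ∀ w u, Φ (FreeGroup.lift b w) (o, u) = (o, w * u) := by
    intro w
    induction w using FreeGroup.induction_on with
    | C1 => intro u; simp
    | of e =>
      intro u
      change Φ (FreeGroup.lift b (of e)) _ = _
      rw [FreeGroup.lift_apply_of, hgen]
    | inv_of e _ =>
      intro u
      change Φ (FreeGroup.lift b (of e)⁻¹) _ = (o, (of e)⁻¹ * u)
      rw [map_inv, map_inv, FreeGroup.lift_apply_of, Equiv.Perm.inv_eq_iff_eq, hgen,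
        mul_inv_cancel_left]
    | mul x y hx hy =>
      intro u
      rw [map_mul, map_mul, Equiv.Perm.mul_apply, hy, hx, mul_assoc]
  -- letters come from traversed edges
  have hletters : ∀ L : List (α × Bool), ∀ e : E, ∀ s : Bool,
      (e, s) ∈ ((Φ (mk L) (o, 1)).2).toWord → ∃ L1 l L2, L = L1 ++ l :: L2 ∧
        ((mk L2 • o = e.1.1 ∧ mk [l] = of e.1.2) ∨
         (mk [l] • mk L2 • o = e.1.1 ∧ mk [l] = (of e.1.2)⁻¹)) := by
    have hεm : ∀ x a (e : E) s, (e, s) ∈ (ε x a).toWord → e.1 = (x, a) := by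
      intro x a e s h
      by_cases h' : B (x, a) ≠ 1
      · simp only [ε, dif_pos h', toWord_of, List.mem_singleton, Prod.mk.injEq] at h
        rw [h.1]
      · simp only [ε, dif_neg h', toWord_one, List.not_mem_nil] at h
    have hεm' : ∀ x a (e : E) s, (e, s) ∈ ((ε x a)⁻¹).toWord → e.1 = (x, a) := by
      intro x a e s h
      rw [toWord_inv] at h
      simp only [invRev, List.mem_reverse, List.mem_map] at h
      obtain ⟨q, hq, hq'⟩ := h
      have := hεm x a q.1 q.2 hq
      rw [← this]
      exact congrArg (fun z => z.1.1) hq'.symm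
    intro L
    induction L with
    | nil =>
      intro e s h
      change (e, s) ∈ ((Φ 1 (o, 1)).2).toWord at h
      simp at h
    | cons l L ih =>
      intro e s h
      have hL : (mk (l :: L) : FreeGroup α) = mk [l] * mk L := by rw [mul_mk]; rfl
      rw [hL, map_mul, Equiv.Perm.mul_apply] at h
      have hfin : (e, s) ∈ ((Φ (mk L) (o, 1)).2).toWord → ∃ L1 l' L2, l :: L = L1 ++ l' :: L2 ∧
        ((mk L2 • o = e.1.1 ∧ mk [l'] = of e.1.2) ∨
         (mk [l'] • mk L2 • o = e.1.1 ∧ mk [l'] = (of e.1.2)⁻¹)) := by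
        intro h
        obtain ⟨L1, l', L2, h1, h2⟩ := ih e s h
        exact ⟨l :: L1, l', L2, by rw [h1]; rfl, h2⟩
      rcases hcase l with ⟨a, -, hl⟩ | ⟨a, -, hl⟩
      · rw [hl, hΦof] at h
        rcases List.mem_append.mp ((toWord_mul_sublist _ _).subset h) with h | h
        · have h1 := hεm _ _ _ _ h
          rw [hfst] at h1
          refine ⟨[], l, L, rfl, Or.inl ?_⟩
          rw [h1]
          exact ⟨rfl, hl⟩
        · exact hfin h
      · rw [hl, hΦinv] at h
        rcases List.mem_append.mp ((toWord_mul_sublist _ _).subset h) with h | h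
        · have h1 := hεm' _ _ _ _ h
          rw [hfst] at h1
          refine ⟨[], l, L, rfl, Or.inr ?_⟩
          rw [h1]
          exact ⟨by rw [hl], hl⟩
        · exact hfin h
  refine ⟨E, inferInstance, b, ?_, ?_, ?_⟩
  · intro w w' h
    have h1 := hw w 1
    rw [h, hw w' 1] at h1
    simpa using (congrArg Prod.snd h1).symm
  · ext g
    constructor
    · rintro ⟨w, rfl⟩
      rw [hmem, ← hfst _ (o, 1), hw]
    · intro hg
      have h1 := hequiv g (o, 1)
      rw [hfst, (hmem g).mp hg, ho1] at h1
      exact ⟨_, by simpa using h1⟩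
  · rintro w e ⟨s, hs⟩
    have h1 := hw w 1
    have hH : (FreeGroup.lift b w) • o = o := by rw [← hfst _ (o, 1), hw]
    generalize FreeGroup.lift b w = g at h1 hH
    have h2 : (e, s) ∈ ((Φ (mk g.toWord) (o, 1)).2).toWord := by
      rw [mk_toWord, h1, mul_one]
      convert hs
    obtain ⟨L1, l, L2, hL, hor⟩ := hletters _ _ _ h2
    have hg : g = mk L1 * (mk [l] * mk L2) := by
      rw [← mk_toWord (x := g), hL, mul_mk, mul_mk]; rfl
    have hlen : g.norm = L1.length + (L2.length + 1) := by
      simp [FreeGroup.norm, hL]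
    have h3 : mk [l] • mk L2 • o = (mk L1)⁻¹ • o := by
      rw [eq_inv_smul_iff, ← mul_smul (mk [l]), ← mul_smul, ← hg, hH]
    have h4 : (τ (mk L2 • o)).norm ≤ L2.length := (hτ2' _).trans norm_mk_le
    have h5 : (τ (mk [l] • mk L2 • o)).norm ≤ L1.length := by
      rw [h3]
      refine (hτ2' _).trans ?_
      rw [norm_inv_eq]
      exact norm_mk_le
    obtain ⟨⟨x, a⟩, he⟩ := e
    have h6 : (B (x, a)).norm ≤ (τ (of a • x)).norm + 1 + (τ x).norm := by
      rw [hB]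
      refine (FreeGroup.norm_mul_le _ _).trans ?_
      have := FreeGroup.norm_mul_le (τ (of a • x))⁻¹ (of a)
      rw [norm_inv_eq, norm_of] at this
      omega
    change (B (x, a)).norm ≤ _
    rcases hor with ⟨hx, hl⟩ | ⟨hx, hl⟩
    · rw [hl, hx] at h5
      rw [hx] at h4
      dsimp only at h4 h5
      omega
    · rw [hx] at h5
      have : mk L2 • o = of a • x := by
        rw [← inv_smul_eq_iff, ← hl]; exact hx
      rw [this] at h4
      dsimp only at h4 h5
      omega

end MinBasis

/-- Corollary 2.3 of Ciobanu–Ould Houcine: every finitely generated subgroup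
`H` of the free group of rank `n ≥ 2` has a free basis `b` of "minimal"
elements: every reduced word `w` on the basis has length at least `|b i|`
for each basis element `b i` occurring in `w`. -/
theorem exists_minimal_basis (n : ℕ) (hn : 2 ≤ n)
    (H : Subgroup (FreeGroup (Fin n))) (hH : H.FG) :
    ∃ m : ℕ, ∃ b : Fin m → FreeGroup (Fin n),
      Function.Injective (FreeGroup.lift b) ∧
      (FreeGroup.lift b).range = H ∧
      ∀ w : FreeGroup (Fin m), ∀ i : Fin m,
        (∃ s : Bool, (i, s) ∈ w.toWord) →
          (b i).norm ≤ ((FreeGroup.lift b) w).norm := by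
  obtain ⟨E, _, b, hinj, hran, hlen⟩ := MinBasis.basis H
  have hfg : Group.FG (FreeGroup E) := by
    have e1 : FreeGroup E ≃* H :=
      (MonoidHom.ofInjective hinj).trans (MulEquiv.subgroupCongr hran)
    have : Group.FG H := (Group.fg_iff_subgroup_fg H).mpr hH
    exact Group.fg_of_surjective (f := e1.symm.toMonoidHom) e1.symm.surjective
  have hfin : Finite E := MinBasis.finite_of_fg hfg
  obtain ⟨m, ⟨f⟩⟩ := Finite.exists_equiv_fin E
  have hcomp : ∀ w, FreeGroup.lift (b ∘ f.symm) w = FreeGroup.lift b (FreeGroup.map f.symm w) := by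
    intro w
    have : FreeGroup.lift (b ∘ f.symm) = (FreeGroup.lift b).comp (FreeGroup.map f.symm) := by
      ext i; simp
    rw [this]; rfl
  refine ⟨m, b ∘ f.symm, ?_, ?_, ?_⟩
  · intro w w' h
    rw [hcomp, hcomp] at h
    exact FreeGroup.map_injective f.symm.injective (hinj h)
  · rw [← hran]
    ext g
    constructor
    · rintro ⟨w, rfl⟩
      exact ⟨_, (hcomp w).symm⟩
    · rintro ⟨w, rfl⟩
      obtain ⟨v, rfl⟩ := FreeGroup.map_surjective f.symm.surjective w
      exact ⟨v, hcomp v⟩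
  · rintro w i ⟨s, hs⟩
    rw [hcomp]
    exact hlen _ _ ⟨s, MinBasis.toWord_map_equiv f.symm w i s hs⟩
end
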